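/- arXiv:2306.10393 — 2 statements merged into one kernel-verified Lean document; each statement's English description precedes it below -/
import Mathlib

section
/- With the standing setup (prime p, l_p, B, Ψ_B, 𝒵_B, b_max, θ_max, A_1(B), A_2(B), P_B, I, odd s, n ∈ I, the rational function R_n and its partial fraction coefficients r_{i,k}, and d_n = lcm(1,…,n)), define ρ_i = Σ_{k=0}^{n} r_{i,k} for 2 ≤ i ≤ s. Then for every i ∈ {2, 3, …, s} the rational number d_n^{s−i} · ρ_i is an integer. -/
/-- The integer `l_p`: `1` if `p ≥ 5`, `2` if `p = 3`, `3` if `p = 2`. -/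
def ellp (p : ℕ) : ℕ := if 5 ≤ p then 1 else if p = 3 then 2 else 3

/-- `d_n = lcm(1, 2, …, n)`. -/
def dd (n : ℕ) : ℕ := (Finset.Icc 1 n).lcm id

/-- The rational function
`R_n(t) = A₁(B)^n A₂(B)^n (n!^{s-|𝒵|+1}/(θ_max n - 1)!) (t+θ_max)_{θ_max n-1}
  ∏_{θ ∈ 𝒵∖{θ_max}} (t+θ)_n / ((t)_{n+1})^s`,
where `Ψ = Ψ_B`, `Z = 𝒵_B`, `θ_max = (p^{l_p} b_max - 1)/(p^{l_p} b_max)` and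
Pochhammer symbols are written as products. -/
noncomputable def Rfun (p : ℕ) (Ψ : Finset ℕ) (Z : Finset ℚ) (bmax s n : ℕ) (t : ℚ) : ℚ :=
  let Nb : ℕ := p ^ ellp p * bmax
  let m : ℕ := (Nb - 1) * n / Nb
  let θmax : ℚ := ((Nb : ℚ) - 1) / (Nb : ℚ)
  let A1 : ℕ := ∏ b ∈ Ψ, (p ^ ellp p * b) ^ (p ^ ellp p * b).totient
  let A2 : ℕ := ∏ b ∈ Ψ, ∏ q ∈ (p ^ ellp p * b).primeFactors,
    q ^ ((p ^ ellp p * b).totient / (q - 1))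
  (A1 : ℚ) ^ n * (A2 : ℚ) ^ n *
    ((Nat.factorial n : ℚ) ^ (s - Z.card + 1) / (Nat.factorial (m - 1) : ℚ)) *
    (∏ j ∈ Finset.range (m - 1), (t + θmax + (j : ℚ))) *
    (∏ θ ∈ Z.erase θmax, ∏ j ∈ Finset.range n, (t + θ + (j : ℚ))) /
    (∏ j ∈ Finset.range (n + 1), (t + (j : ℚ))) ^ s

open PowerSeries in
/-- Power series `f` over `ℚ` such that `f(dX)` has integer coefficients. -/
noncomputable def SS (d : ℕ) : Subring (PowerSeries ℚ) :=
  ((PowerSeries.map (Int.castRingHom ℚ)).range).comap (PowerSeries.rescale (d : ℚ))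

lemma SS_coeff {d : ℕ} {f : PowerSeries ℚ} (h : f ∈ SS d) (i : ℕ) :
    ∃ z : ℤ, (d : ℚ) ^ i * PowerSeries.coeff i f = z := by
  obtain ⟨g, hg⟩ := h
  refine ⟨PowerSeries.coeff i g, ?_⟩
  have := congrArg (PowerSeries.coeff i) hg
  rw [PowerSeries.coeff_map, PowerSeries.coeff_rescale] at this
  rw [← this]; simp

lemma SS_C (d : ℕ) (z : ℤ) : (PowerSeries.C (z : ℚ)) ∈ SS d := by
  have : (PowerSeries.C (z : ℚ)) = ((z : ℤ) : PowerSeries ℚ) := by simp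
  rw [this]
  exact intCast_mem _ z

lemma SS_CX {d : ℕ} {c : ℚ} {z : ℤ} (h : c * d = z) :
    (PowerSeries.C c * PowerSeries.X) ∈ SS d := by
  refine ⟨PowerSeries.C z * PowerSeries.X, ?_⟩
  have h1 : PowerSeries.rescale (d : ℚ) (PowerSeries.C c) = PowerSeries.C c := by
    ext i; rw [PowerSeries.coeff_rescale, PowerSeries.coeff_C]; split_ifs with h <;> simp [h]
  rw [map_mul, map_mul, PowerSeries.rescale_X, h1, ← mul_assoc, ← map_mul PowerSeries.C c, h]
  simp

lemma SS_inv {d : ℕ} {c : ℚ} {z : ℤ} (h : c * d = z) :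
    (1 + PowerSeries.C c * PowerSeries.X)⁻¹ ∈ SS d := by
  have hu : IsUnit (1 + PowerSeries.C z * PowerSeries.X : PowerSeries ℤ) := by
    rw [PowerSeries.isUnit_iff_constantCoeff]; simp
  obtain ⟨g, hg⟩ := hu.exists_right_inv
  refine ⟨g, ?_⟩
  have h1 : PowerSeries.rescale (d : ℚ) (PowerSeries.C c) = PowerSeries.C c := by
    ext i; rw [PowerSeries.coeff_rescale, PowerSeries.coeff_C]; split_ifs with h <;> simp [h]
  have h2 : PowerSeries.map (Int.castRingHom ℚ) (1 + PowerSeries.C z * PowerSeries.X)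
      = PowerSeries.rescale (d : ℚ) (1 + PowerSeries.C c * PowerSeries.X) := by
    rw [map_add, map_add, map_mul, map_mul, PowerSeries.rescale_X, h1, ← mul_assoc, ← map_mul PowerSeries.C c, h]
    simp
  have h3 : (1 + PowerSeries.C c * PowerSeries.X : PowerSeries ℚ) *
      (1 + PowerSeries.C c * PowerSeries.X)⁻¹ = 1 := by
    apply PowerSeries.mul_inv_cancel; simp
  have h4 := congrArg (PowerSeries.map (Int.castRingHom ℚ)) hg
  have h5 := congrArg (PowerSeries.rescale (d : ℚ)) h3
  rw [map_mul, h2, map_one] at h4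
  rw [map_mul, map_one] at h5
  set u := PowerSeries.rescale (d : ℚ) (1 + PowerSeries.C c * PowerSeries.X)
  set v := PowerSeries.rescale (d : ℚ) (1 + PowerSeries.C c * PowerSeries.X)⁻¹
  change PowerSeries.map (Int.castRingHom ℚ) g = v
  set w := PowerSeries.map (Int.castRingHom ℚ) g
  calc w = (u * v) * w := by rw [h5, one_mul]
    _ = (u * w) * v := by ring
    _ = v := by rw [h4, one_mul]

lemma dvd_dd {l n : ℕ} (h1 : 1 ≤ l) (h2 : l ≤ n) : l ∣ dd n :=
  Finset.dvd_lcm (f := id) (Finset.mem_Icc.mpr ⟨h1, h2⟩)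

lemma inv_mul_dd {l n : ℕ} (h1 : 1 ≤ l) (h2 : l ≤ n) : ∃ z : ℤ, (l : ℚ)⁻¹ * (dd n : ℚ) = z := by
  obtain ⟨c, hc⟩ := dvd_dd h1 h2
  refine ⟨c, ?_⟩
  have : (l : ℚ) ≠ 0 := by positivity
  rw [hc]; push_cast; field_simp

/-- `binom(X, i)` is in the ring. -/
lemma SS_choose {n i : ℕ} (hi : i ≤ n) :
    (PowerSeries.C ((i.factorial : ℚ)⁻¹) * ∏ l ∈ Finset.range i, (PowerSeries.X - PowerSeries.C (l : ℚ)))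
      ∈ SS (dd n) := by
  rcases i with _ | i
  · simp
  have key : ∀ j : ℕ, (PowerSeries.C (((j + 1).factorial : ℚ)⁻¹) *
      ∏ l ∈ Finset.range (j + 1), (PowerSeries.X - PowerSeries.C (l : ℚ))) =
      (PowerSeries.C (((j + 1 : ℕ) : ℚ)⁻¹) * PowerSeries.X) * ∏ l ∈ Finset.range j,
        (PowerSeries.C (((l + 1 : ℕ) : ℚ)⁻¹) * PowerSeries.X - 1) := by
    intro j
    rw [Finset.prod_range_succ']
    have h : ∀ l : ℕ, (PowerSeries.X - PowerSeries.C ((l + 1 : ℕ) : ℚ)) = PowerSeries.C ((l + 1 : ℕ) : ℚ) *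
        (PowerSeries.C (((l + 1 : ℕ) : ℚ)⁻¹) * PowerSeries.X - 1) := by
      intro l
      rw [mul_sub, ← mul_assoc, ← map_mul, mul_inv_cancel₀ (by positivity)]
      simp
    simp_rw [h]
    rw [Finset.prod_mul_distrib, ← map_prod, ← Nat.cast_prod, Finset.prod_range_add_one_eq_factorial]
    have : (((j + 1 : ℕ) : ℚ)⁻¹) = ((j + 1).factorial : ℚ)⁻¹ * (j.factorial : ℚ) := by
      rw [Nat.factorial_succ]; push_cast; field_simp
    rw [this, map_mul]
    simp only [Nat.cast_zero, map_zero, sub_zero]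
    ring
  rw [key]
  refine mul_mem ?_ (prod_mem fun l hl => sub_mem ?_ (one_mem _))
  · obtain ⟨z, hz⟩ := inv_mul_dd (n := n) (l := i + 1) (by omega) hi
    exact SS_CX hz
  · have := Finset.mem_range.mp hl
    obtain ⟨z, hz⟩ := inv_mul_dd (n := n) (l := l + 1) (by omega) (by omega)
    exact SS_CX hz

lemma desc_smeval {R : Type*} [CommRing R] (r : R) (k : ℕ) :
    (descPochhammer ℤ k).smeval r = ∏ j ∈ Finset.range k, (r - (j : R)) := by
  induction k with
  | zero => simp
  | succ k ih =>
    rw [descPochhammer_succ_right, Polynomial.smeval_mul, ih, Finset.prod_range_succ,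
      Polynomial.smeval_sub, Polynomial.smeval_X, Polynomial.smeval_natCast]
    simp

lemma vander {R : Type*} [CommRing R] (r s : R) (k : ℕ) :
    ∏ j ∈ Finset.range k, (r + s - (j : R)) = ∑ ij ∈ Finset.HasAntidiagonal.antidiagonal k,
      Nat.choose k ij.1 * ((∏ j ∈ Finset.range ij.1, (r - (j : R))) *
        (∏ j ∈ Finset.range ij.2, (s - (j : R)))) := by
  rw [← desc_smeval, Ring.descPochhammer_smeval_add k (Commute.all r s)]
  simp_rw [desc_smeval]

/-- `μ_n(D)`. -/
def muu (D n : ℕ) : ℕ := ∏ q ∈ D.primeFactors, q ^ (n / (q - 1))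

lemma fact_dvd (D n i : ℕ) (hi : i ≤ n) (a : ℤ) (hD : D ≠ 0) :
    (i.factorial : ℤ) ∣ (muu D n : ℤ) * ∏ l ∈ Finset.range i, (a - D * l) := by
  rw [Int.natCast_dvd, Nat.dvd_iff_prime_pow_dvd_dvd]
  intro q k hq hk
  rw [Int.natAbs_mul, Int.natAbs_natCast]
  by_cases hqD : q ∣ D
  · apply Dvd.dvd.mul_right
    have : q ^ k ∣ q ^ (n / (q - 1)) := by
      apply pow_dvd_pow
      have := Fact.mk hq
      have h1 := (padicValNat_dvd_iff_le (p := q) (Nat.factorial_ne_zero i)).mp hk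
      have h2 := sub_one_mul_padicValNat_factorial (p := q) i
      rw [Nat.le_div_iff_mul_le (by have := hq.two_le; omega)]
      calc k * (q - 1) ≤ padicValNat q i.factorial * (q - 1) := Nat.mul_le_mul_right _ h1
        _ ≤ i := by rw [mul_comm, h2]; omega
        _ ≤ n := hi
    exact this.trans (Finset.dvd_prod_of_mem (fun q => q ^ (n / (q - 1)))
      (Nat.mem_primeFactors.mpr ⟨hq, hqD, hD⟩))
  · apply Dvd.dvd.mul_left
    rw [← Int.natCast_dvd]
    have hc : IsCoprime ((q ^ k : ℕ) : ℤ) (D : ℤ) := by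
      rw [Nat.isCoprime_iff_coprime]
      exact Nat.Coprime.pow_left _ ((Nat.Prime.coprime_iff_not_dvd hq).mpr hqD)
    obtain ⟨u, v, huv⟩ := hc
    have h1 : ((q ^ k : ℕ) : ℤ) ∣ ∏ l ∈ Finset.range i, (-(v * a) + l) :=
      (Int.natCast_dvd_natCast.mpr hk).trans (Nat.factorial_coe_dvd_prod i _)
    have h2 : ((q ^ k : ℕ) : ℤ) ∣ ∏ l ∈ Finset.range i, (v * -(a - D * l)) := by
      refine (Int.modEq_zero_iff_dvd).mp ?_
      refine Int.ModEq.trans ?_ ((Int.modEq_zero_iff_dvd).mpr h1)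
      refine Int.ModEq.prod fun l _ => ?_
      refine (Int.modEq_iff_dvd).mpr ⟨u * l, ?_⟩
      linear_combination (-(l:ℤ)) * huv
    rw [Finset.prod_mul_distrib, Finset.prod_neg, Finset.prod_const] at h2
    have hc' : IsCoprime ((q ^ k : ℕ) : ℤ) (v ^ (Finset.range i).card) :=
      IsCoprime.pow_right ⟨u, D, by linear_combination huv⟩
    have h3 := hc'.dvd_of_dvd_mul_left h2
    have hc2 : IsCoprime ((q ^ k : ℕ) : ℤ) ((-1) ^ (Finset.range i).card) :=
      IsCoprime.pow_right isCoprime_one_right.neg_right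
    exact hc2.dvd_of_dvd_mul_left h3

/-- The numerator building block. -/
lemma SS_block (D n M : ℕ) (hM : M ≤ n) (a : ℤ) (hD : D ≠ 0) :
    (PowerSeries.C (((D : ℚ) ^ n * muu D n) / M.factorial) *
      ∏ j ∈ Finset.range M, (PowerSeries.X + PowerSeries.C ((a : ℚ) / D + j))) ∈ SS (dd n) := by
  have hD' : (D : ℚ) ≠ 0 := by exact_mod_cast hD
  have e1 : ∏ j ∈ Finset.range M, (PowerSeries.X + PowerSeries.C ((a : ℚ) / D + j)) =
      ∏ j ∈ Finset.range M, (PowerSeries.X + PowerSeries.C (((a + D * (M - 1) : ℤ) : ℚ) / D)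
        - ((j : ℕ) : PowerSeries ℚ)) := by
    rw [← Finset.prod_range_reflect]
    refine Finset.prod_congr rfl fun j hj => ?_
    have hj := Finset.mem_range.mp hj
    have : ((j : ℕ) : PowerSeries ℚ) = PowerSeries.C (j : ℚ) := by simp
    rw [this, add_sub_assoc, ← map_sub]
    congr 2
    rw [Nat.cast_sub (by omega), Nat.cast_sub (by omega)]
    push_cast
    field_simp
    ring
  rw [e1]
  generalize (a + D * (M - 1) : ℤ) = b
  rw [vander, Finset.mul_sum]
  refine sum_mem fun ij hij => ?_
  obtain ⟨i, j⟩ := ij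
  have hij : i + j = M := by simpa using hij
  obtain ⟨z, hz⟩ := fact_dvd D n j (by omega) b hD
  have e2 : (∏ l ∈ Finset.range j, (PowerSeries.C ((b : ℚ) / D) - ((l : ℕ) : PowerSeries ℚ))) =
      PowerSeries.C ((∏ l ∈ Finset.range j, ((b : ℚ) - D * l)) / (D : ℚ) ^ j) := by
    have hp : (D : ℚ) ^ j = ∏ _l ∈ Finset.range j, (D : ℚ) := by simp
    rw [hp, ← Finset.prod_div_distrib, map_prod]
    refine Finset.prod_congr rfl fun l _ => ?_
    have : ((l : ℕ) : PowerSeries ℚ) = PowerSeries.C (l : ℚ) := by simp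
    rw [this, ← map_sub]
    congr 1
    field_simp
  have e3 : ((M.choose i : ℕ) : PowerSeries ℚ) = PowerSeries.C (M.choose i : ℚ) := by simp
  have e4 : (((D : ℚ) ^ n * muu D n) / M.factorial) * (M.choose i : ℚ) *
      ((∏ l ∈ Finset.range j, ((b : ℚ) - D * l)) / (D : ℚ) ^ j) =
      (((D : ℤ) ^ (n - j) * z : ℤ) : ℚ) * (i.factorial : ℚ)⁻¹ := by
    have hz' : (muu D n : ℚ) * ∏ l ∈ Finset.range j, ((b : ℚ) - D * l) = j.factorial * z := by
      exact_mod_cast hz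
    have h5 : (M.factorial : ℚ) = M.choose i * i.factorial * j.factorial := by
      have := Nat.choose_mul_factorial_mul_factorial (n := M) (k := i) (by omega)
      rw [show M - i = j by omega] at this
      exact_mod_cast this.symm
    have h6 : (M.choose i : ℚ) ≠ 0 := by
      exact_mod_cast (Nat.choose_pos (by omega)).ne'
    have h7 : (D : ℚ) ^ n = (D : ℚ) ^ (n - j) * (D : ℚ) ^ j := by
      rw [← pow_add]; congr 1; omega
    have h8 : (i.factorial : ℚ) ≠ 0 := by positivity
    have h9 : (j.factorial : ℚ) ≠ 0 := by positivity
    rw [h5, h7]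
    push_cast
    field_simp
    linear_combination hz'
  have e5 : ∀ l : ℕ, ((l : ℕ) : PowerSeries ℚ) = PowerSeries.C (l : ℚ) := by intro l; simp
  have e6 := mul_mem (SS_C (dd n) ((D : ℤ) ^ (n - j) * z)) (SS_choose (n := n) (i := i) (by omega))
  rw [← mul_assoc, ← map_mul, ← e4, map_mul, map_mul] at e6
  dsimp only
  rw [e2, e3]
  simp only [e5]
  convert e6 using 1
  ring

lemma prod_lk (k m : ℕ) : ∏ l ∈ (Finset.range (k + m + 1)).erase k, ((l : ℚ) - k) =
    (-1) ^ k * k.factorial * m.factorial := by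
  induction m with
  | zero =>
    have : (Finset.range (k + 0 + 1)).erase k = Finset.range k := by
      ext x; simp; omega
    rw [this, ← Finset.prod_range_reflect, ← Finset.prod_range_add_one_eq_factorial]
    have h : ∀ j ∈ Finset.range k, (((k - 1 - j : ℕ) : ℚ) - k) = (-1) * ((j + 1 : ℕ) : ℚ) := by
      intro j hj
      have := Finset.mem_range.mp hj
      rw [Nat.cast_sub (by omega), Nat.cast_sub (by omega)]; push_cast; ring
    rw [Finset.prod_congr rfl h, Finset.prod_mul_distrib, Nat.cast_prod]
    simp
  | succ m ih =>
    have : (Finset.range (k + (m + 1) + 1)).erase k =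
        insert (k + m + 1) ((Finset.range (k + m + 1)).erase k) := by
      ext x; simp; omega
    rw [this, Finset.prod_insert (by simp), ih, Nat.factorial_succ]
    push_cast; ring

/-- `∏_{l ≠ k} (X + l - k)`. -/
noncomputable def QQ (n k : ℕ) : PowerSeries ℚ :=
  ∏ l ∈ (Finset.range (n + 1)).erase k, (PowerSeries.X + PowerSeries.C ((l : ℚ) - k))

lemma SS_G (n k : ℕ) (hk : k ≤ n) : ∃ G ∈ SS (dd n), G * QQ n k = PowerSeries.C (n.factorial : ℚ) := by
  refine ⟨PowerSeries.C (((-1) ^ k * n.choose k : ℤ) : ℚ) *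
    ∏ l ∈ (Finset.range (n + 1)).erase k, (1 + PowerSeries.C ((l : ℚ) - k)⁻¹ * PowerSeries.X)⁻¹, ?_, ?_⟩
  · refine mul_mem (SS_C _ _) (prod_mem fun l hl => ?_)
    have hl1 : l ≠ k := Finset.ne_of_mem_erase hl
    have hl2 := Finset.mem_range.mp (Finset.mem_of_mem_erase hl)
    rcases lt_or_gt_of_ne hl1 with h | h
    · obtain ⟨z, hz⟩ := inv_mul_dd (n := n) (l := k - l) (by omega) (by omega)
      refine SS_inv (z := -z) ?_
      rw [Nat.cast_sub h.le] at hz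
      push_cast
      rw [← hz, ← neg_sub, inv_neg, neg_mul]
    · obtain ⟨z, hz⟩ := inv_mul_dd (n := n) (l := l - k) (by omega) (by omega)
      refine SS_inv (z := z) ?_
      rw [Nat.cast_sub h.le] at hz
      exact hz
  · rw [QQ, mul_assoc, ← Finset.prod_mul_distrib]
    have h : ∀ l ∈ (Finset.range (n + 1)).erase k,
        (1 + PowerSeries.C ((l : ℚ) - k)⁻¹ * PowerSeries.X)⁻¹ *
          (PowerSeries.X + PowerSeries.C ((l : ℚ) - k)) = PowerSeries.C ((l : ℚ) - k) := by
      intro l hl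
      have hl1 : l ≠ k := Finset.ne_of_mem_erase hl
      have h0 : (l : ℚ) - k ≠ 0 := sub_ne_zero.mpr (by exact_mod_cast hl1)
      have h1 : (PowerSeries.X + PowerSeries.C ((l : ℚ) - k)) =
        (1 + PowerSeries.C ((l : ℚ) - k)⁻¹ * PowerSeries.X) * PowerSeries.C ((l : ℚ) - k) := by
        rw [add_mul, one_mul, mul_right_comm, ← map_mul, inv_mul_cancel₀ h0, map_one, one_mul, add_comm]
      rw [h1, ← mul_assoc, PowerSeries.inv_mul_cancel _ (by simp), one_mul]
    rw [Finset.prod_congr rfl h, ← map_prod, ← map_mul]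
    congr 1
    obtain ⟨m, rfl⟩ := Nat.exists_eq_add_of_le hk
    rw [prod_lk]
    have := Nat.choose_mul_factorial_mul_factorial (n := k + m) (k := k) (by omega)
    rw [show k + m - k = m by omega] at this
    rw [← this]
    push_cast
    have h2 : ((-1 : ℚ) ^ k) * (-1) ^ k = 1 := by rw [← mul_pow]; simp
    linear_combination ((k + m).choose k * k.factorial * m.factorial : ℚ) * h2

lemma extract (n s k d : ℕ) (hk : k ≤ n) (T : Polynomial ℚ) (r : ℕ → ℕ → ℚ)
    (h : ∀ u : ℚ, (∀ j ∈ Finset.range (n + 1), u - k + (j : ℚ) ≠ 0) →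
      T.eval u / (∏ j ∈ Finset.range (n + 1), (u - k + (j : ℚ))) ^ s =
        ∑ i ∈ Finset.Icc 1 s, ∑ j ∈ Finset.range (n + 1), r i j / (u - k + (j : ℚ)) ^ i)
    (V : PowerSeries ℚ) (hV : V ∈ SS d) (hVT : V * QQ n k ^ s = (T : PowerSeries ℚ)) :
    ∀ i ∈ Finset.Icc 1 s, ∃ z : ℤ, (d : ℚ) ^ (s - i) * r i k = z := by
  classical
  set E : ℕ → Polynomial ℚ := fun j =>
    ∏ l ∈ (Finset.range (n + 1)).erase j, (Polynomial.X + Polynomial.C ((l : ℚ) - k)) with hE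
  have hkm : k ∈ Finset.range (n + 1) := Finset.mem_range.mpr (by omega)
  have hT : T = ∑ i ∈ Finset.Icc 1 s, ∑ j ∈ Finset.range (n + 1),
      Polynomial.C (r i j) * (Polynomial.X + Polynomial.C ((j : ℚ) - k)) ^ (s - i) * E j ^ s := by
    apply Polynomial.eq_of_infinite_eval_eq
    have hfin : ((Finset.range (n + 1)).image (fun j : ℕ => (k : ℚ) - j) : Set ℚ).Finite :=
      Finset.finite_toSet _
    refine hfin.infinite_compl.mono fun u hu => ?_
    have hu' : ∀ j ∈ Finset.range (n + 1), u - k + (j : ℚ) ≠ 0 := by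
      intro j hj h0
      apply hu
      simp only [Finset.coe_image, Set.mem_image]
      exact ⟨j, hj, by linarith⟩
    have hP : (∏ j ∈ Finset.range (n + 1), (u - k + (j : ℚ))) ≠ 0 := Finset.prod_ne_zero_iff.mpr hu'
    have h1 := h u hu'
    rw [div_eq_iff (pow_ne_zero _ hP)] at h1
    simp only [Set.mem_ofPred_eq]
    rw [h1, Finset.sum_mul, Polynomial.eval_finsetSum]
    refine Finset.sum_congr rfl fun i hi => ?_
    have hi := Finset.mem_Icc.mp hi
    rw [Finset.sum_mul, Polynomial.eval_finsetSum]
    refine Finset.sum_congr rfl fun j hj => ?_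
    rw [← Finset.mul_prod_erase _ _ hj]
    simp only [hE, Polynomial.eval_mul, Polynomial.eval_pow, Polynomial.eval_prod, Polynomial.eval_add,
      Polynomial.eval_X, Polynomial.eval_C]
    have h2 : ∀ l : ℕ, u + ((l : ℚ) - k) = u - k + l := fun l => by ring
    simp only [h2]
    rw [mul_pow]
    have h3 : (u - k + (j : ℚ)) ^ s = (u - k + (j : ℚ)) ^ (s - i) * (u - k + (j : ℚ)) ^ i := by
      rw [← pow_add]; congr 1; omega
    have := hu' j hj
    rw [h3]
    field_simp
  have hX : ∀ j ∈ (Finset.range (n + 1)).erase k, Polynomial.X ∣ E j := by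
    intro j hj
    have : (Polynomial.X : Polynomial ℚ) = Polynomial.X + Polynomial.C ((k : ℚ) - k) := by simp
    rw [this]
    exact Finset.dvd_prod_of_mem (fun l : ℕ => (Polynomial.X + Polynomial.C ((l : ℚ) - k)))
      (Finset.mem_erase.mpr ⟨(Finset.ne_of_mem_erase hj).symm, hkm⟩)
  have hW : ∃ W : Polynomial ℚ, T = (∑ i ∈ Finset.Icc 1 s,
      Polynomial.C (r i k) * Polynomial.X ^ (s - i)) * E k ^ s + Polynomial.X ^ s * W := by
    have hd : (Polynomial.X ^ s : Polynomial ℚ) ∣ ∑ i ∈ Finset.Icc 1 s, ∑ j ∈ (Finset.range (n + 1)).erase k,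
      Polynomial.C (r i j) * (Polynomial.X + Polynomial.C ((j : ℚ) - k)) ^ (s - i) * E j ^ s :=
      Finset.dvd_sum fun i _ => Finset.dvd_sum fun j hj =>
        Dvd.dvd.mul_left (pow_dvd_pow_of_dvd (hX j hj) s) _
    obtain ⟨W, hW⟩ := hd
    refine ⟨W, ?_⟩
    rw [hT, ← hW, Finset.sum_mul, ← Finset.sum_add_distrib]
    refine Finset.sum_congr rfl fun i _ => ?_
    rw [← Finset.add_sum_erase _ _ hkm]
    simp
  obtain ⟨W, hW⟩ := hW
  have hφE : ((E k : Polynomial ℚ) : PowerSeries ℚ) = QQ n k := by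
    have : ((E k : Polynomial ℚ) : PowerSeries ℚ) = Polynomial.coeToPowerSeries.ringHom (E k) := rfl
    rw [this, hE, QQ, map_prod]
    refine Finset.prod_congr rfl fun l _ => ?_
    rw [Polynomial.coeToPowerSeries.ringHom_apply, Polynomial.coe_add, Polynomial.coe_X, Polynomial.coe_C]
  have hφ : ((∑ i ∈ Finset.Icc 1 s, Polynomial.C (r i k) * Polynomial.X ^ (s - i) : Polynomial ℚ) :
      PowerSeries ℚ) = ∑ i ∈ Finset.Icc 1 s, PowerSeries.C (r i k) * PowerSeries.X ^ (s - i) := by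
    rw [← Polynomial.coeToPowerSeries.ringHom_apply, map_sum]
    refine Finset.sum_congr rfl fun l _ => ?_
    rw [Polynomial.coeToPowerSeries.ringHom_apply, Polynomial.coe_mul, Polynomial.coe_pow,
      Polynomial.coe_X, Polynomial.coe_C]
  rw [hW, Polynomial.coe_add, Polynomial.coe_mul, Polynomial.coe_mul, Polynomial.coe_pow, hφE, hφ,
    Polynomial.coe_pow, Polynomial.coe_X] at hVT
  have hc : PowerSeries.constantCoeff (QQ n k) ≠ 0 := by
    rw [QQ, map_prod, Finset.prod_ne_zero_iff]
    intro l hl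
    have hl1 : l ≠ k := Finset.ne_of_mem_erase hl
    simpa [sub_eq_zero] using hl1
  have hQ := PowerSeries.mul_inv_cancel _ hc
  set Q := QQ n k
  have hV2 : V = (∑ i ∈ Finset.Icc 1 s, PowerSeries.C (r i k) * PowerSeries.X ^ (s - i)) +
      PowerSeries.X ^ s * ((W : PowerSeries ℚ) * Q⁻¹ ^ s) := by
    have hQs : Q ^ s * Q⁻¹ ^ s = 1 := by rw [← mul_pow, hQ, one_pow]
    calc V = V * Q ^ s * Q⁻¹ ^ s := by rw [mul_assoc, hQs, mul_one]
      _ = _ := by rw [hVT, add_mul, mul_assoc, hQs, mul_one, mul_assoc]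
  intro i hi
  have hi' := Finset.mem_Icc.mp hi
  have hcoef : PowerSeries.coeff (s - i) V = r i k := by
    rw [hV2, map_add, PowerSeries.coeff_X_pow_mul', if_neg (by omega), add_zero, map_sum,
      Finset.sum_eq_single i]
    · simp [PowerSeries.coeff_X_pow]
    · intro b hb hbi
      have := Finset.mem_Icc.mp hb
      rw [PowerSeries.coeff_C_mul, PowerSeries.coeff_X_pow, if_neg (by omega), mul_zero]
    · intro h; exact absurd hi h
  rw [← hcoef]
  exact SS_coeff hV _

lemma fiber (c : ℕ) (hc : 2 ≤ c) (Ψ : Finset ℕ) (hΨ : ∀ b ∈ Ψ, 1 ≤ b) (Z : Finset ℚ)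
    (hZ : ∀ x : ℚ, x ∈ Z ↔ ∃ a b : ℕ, b ∈ Ψ ∧ 1 ≤ a ∧ a ≤ c * b ∧
      Nat.gcd a (c * b) = 1 ∧ x = (a : ℚ) / ((c * b : ℕ) : ℚ)) (g : ℕ → ℚ) :
    ∏ θ ∈ Z, g θ.den = ∏ b ∈ Ψ, g (c * b) ^ (c * b).totient := by
  have hden : ∀ a b : ℕ, b ∈ Ψ → Nat.gcd a (c * b) = 1 →
      ((a : ℚ) / ((c * b : ℕ) : ℚ)).den = c * b ∧ ((a : ℚ) / ((c * b : ℕ) : ℚ)).num = a := by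
    intro a b hb hg
    have hpos : 0 < c * b := Nat.mul_pos (by omega) (hΨ b hb)
    have h1 := Rat.den_div_eq_of_coprime (a := (a : ℤ)) (b := ((c * b : ℕ) : ℤ)) (by exact_mod_cast hpos)
      (by rw [Int.natAbs_natCast, Int.natAbs_natCast]; exact hg)
    have h2 := Rat.num_div_eq_of_coprime (a := (a : ℤ)) (b := ((c * b : ℕ) : ℤ)) (by exact_mod_cast hpos)
      (by rw [Int.natAbs_natCast, Int.natAbs_natCast]; exact hg)
    constructor
    · rw [Int.cast_natCast, Int.cast_natCast] at h1
      exact Int.ofNat.inj h1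
    · rw [Int.cast_natCast, Int.cast_natCast] at h2
      exact h2
  have h1 : ∏ b ∈ Ψ, g (c * b) ^ (c * b).totient =
      ∏ x ∈ Ψ.sigma (fun b => (Finset.range (c * b)).filter (fun a => (c * b).Coprime a)), g (c * x.1) := by
    rw [Finset.prod_sigma]
    refine Finset.prod_congr rfl fun b _ => ?_
    simp only [Finset.prod_const, Nat.totient_eq_card_coprime]
  rw [h1]
  symm
  refine Finset.prod_bij (fun x _ => (x.2 : ℚ) / ((c * x.1 : ℕ) : ℚ)) ?_ ?_ ?_ ?_
  · rintro ⟨b, a⟩ hx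
    simp only [Finset.mem_sigma, Finset.mem_filter, Finset.mem_range] at hx
    obtain ⟨hb, ha, hg⟩ := hx
    rw [hZ]
    refine ⟨a, b, hb, ?_, ha.le, Nat.Coprime.symm hg, rfl⟩
    rcases Nat.eq_zero_or_pos a with h | h
    · subst h
      have := hΨ b hb
      rw [Nat.coprime_zero_right] at hg
      nlinarith
    · exact h
  · rintro ⟨b, a⟩ hx ⟨b', a'⟩ hx' he
    simp only [Finset.mem_sigma, Finset.mem_filter, Finset.mem_range] at hx hx' he
    obtain ⟨hb, ha, hg⟩ := hx
    obtain ⟨hb', ha', hg'⟩ := hx'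
    have e1 := hden a b hb (Nat.Coprime.symm hg)
    have e2 := hden a' b' hb' (Nat.Coprime.symm hg')
    rw [he] at e1
    have e3 : c * b = c * b' := e1.1.symm.trans e2.1
    have e4 : a = a' := by exact_mod_cast e1.2.symm.trans e2.2
    have e5 : b = b' := Nat.eq_of_mul_eq_mul_left (by omega) e3
    subst e4 e5; rfl
  · intro x hx
    obtain ⟨a, b, hb, h1a, ha, hg, rfl⟩ := (hZ x).mp hx
    refine ⟨⟨b, a⟩, ?_, rfl⟩
    simp only [Finset.mem_sigma, Finset.mem_filter, Finset.mem_range]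
    refine ⟨hb, lt_of_le_of_ne ha ?_, Nat.Coprime.symm hg⟩
    rintro rfl
    rw [Nat.gcd_self] at hg
    have := hΨ b hb
    nlinarith
  · rintro ⟨b, a⟩ hx
    simp only [Finset.mem_sigma, Finset.mem_filter, Finset.mem_range] at hx
    obtain ⟨hb, ha, hg⟩ := hx
    rw [(hden a b hb (Nat.Coprime.symm hg)).1]

lemma block_eq (θ : ℚ) (k n M : ℕ) (hM : M ≤ n) :
    (PowerSeries.C (((θ.den : ℚ) ^ n * muu θ.den n) / M.factorial) *
      ∏ j ∈ Finset.range M, (PowerSeries.X + PowerSeries.C (θ - k + j))) ∈ SS (dd n) := by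
  have h := SS_block θ.den n M hM (θ.num - k * θ.den) θ.den_nz
  have e : (((θ.num - k * θ.den : ℤ) : ℚ) / θ.den) = θ - k := by
    have h0 : (θ.den : ℚ) ≠ 0 := by exact_mod_cast θ.den_nz
    push_cast
    rw [sub_div, mul_div_cancel_right₀ _ h0, Rat.num_div_den]
  rw [e] at h
  exact h

lemma A_eq (c : ℕ) (hc : 2 ≤ c) (Ψ : Finset ℕ) (hΨ : ∀ b ∈ Ψ, 1 ≤ b) (Z : Finset ℚ)
    (hZ : ∀ x : ℚ, x ∈ Z ↔ ∃ a b : ℕ, b ∈ Ψ ∧ 1 ≤ a ∧ a ≤ c * b ∧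
      Nat.gcd a (c * b) = 1 ∧ x = (a : ℚ) / ((c * b : ℕ) : ℚ)) (n : ℕ)
    (hn : ∀ b ∈ Ψ, ∀ q ∈ (c * b).primeFactors, q - 1 ∣ n) :
    (((∏ b ∈ Ψ, (c * b) ^ (c * b).totient : ℕ) : ℚ) ^ n *
      ((∏ b ∈ Ψ, ∏ q ∈ (c * b).primeFactors, q ^ ((c * b).totient / (q - 1)) : ℕ) : ℚ) ^ n) =
    ∏ θ ∈ Z, ((θ.den : ℚ) ^ n * muu θ.den n) := by
  rw [fiber c hc Ψ hΨ Z hZ (fun D => (D : ℚ) ^ n * muu D n)]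
  norm_cast
  rw [← mul_pow, ← Finset.prod_mul_distrib, ← Finset.prod_pow]
  refine Finset.prod_congr rfl fun b hb => ?_
  rw [mul_pow ((c * b) ^ (c * b).totient) _ n, mul_pow ((c * b) ^ n), ← pow_mul, ← pow_mul, mul_comm n]
  congr 1
  rw [muu, ← Finset.prod_pow, ← Finset.prod_pow]
  refine Finset.prod_congr rfl fun q hq => ?_
  rw [← pow_mul, ← pow_mul]
  congr 1
  have hqp := Nat.prime_of_mem_primeFactors hq
  obtain ⟨x, hx⟩ := hn b hb q hq
  have h2 : q - 1 ∣ (c * b).totient := by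
    have := Nat.totient_dvd_of_dvd (Nat.dvd_of_mem_primeFactors hq)
    rwa [Nat.totient_prime hqp] at this
  obtain ⟨y, hy⟩ := h2
  have h3 : 0 < q - 1 := by have := hqp.two_le; omega
  rw [hy, hx, Nat.mul_div_cancel_left _ h3, Nat.mul_div_cancel_left _ h3]
  ring

/-- Lemma 5.4: `d_n^{s-i} · ρ_i ∈ ℤ` for `ρ_i = ∑_{k=0}^n r_{i,k}`,
`2 ≤ i ≤ s`. -/
theorem dn_pow_mul_rho_i_int
    (p : ℕ) [Fact p.Prime] (B : ℝ) (Ψ : Finset ℕ)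
    (hΨ : ∀ b : ℕ, b ∈ Ψ ↔ 1 ≤ b ∧ ((p ^ ellp p * b).totient : ℝ) ≤ B)
    (bmax : ℕ) (hbmem : bmax ∈ Ψ) (hbmax : ∀ b ∈ Ψ, b ≤ bmax)
    (Z : Finset ℚ)
    (hZ : ∀ x : ℚ, x ∈ Z ↔ ∃ a b : ℕ, b ∈ Ψ ∧ 1 ≤ a ∧ a ≤ p ^ ellp p * b ∧
      Nat.gcd a (p ^ ellp p * b) = 1 ∧ x = (a : ℚ) / ((p ^ ellp p * b : ℕ) : ℚ))
    (s : ℕ) (hsodd : Odd s) (hscard : Z.card + 1 < s)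
    (n : ℕ) (hnprime : (n + 1).Prime)
    (hndvd : ((Ψ.biUnion fun b => (p ^ ellp p * b).primeFactors).lcm (fun q => q - 1)) *
      p ^ ellp p * bmax ∣ n)
    (hdeg : (2 : ℤ) ≤ ((n : ℤ) + 1) * s - n * ((Z.card : ℤ) - 1) -
      (((p ^ ellp p * bmax - 1) * n / (p ^ ellp p * bmax) : ℕ) : ℤ) + 1)
    (r : ℕ → ℕ → ℚ)
    (hr : ∀ t : ℚ, (∀ j ∈ Finset.range (n + 1), t + (j : ℚ) ≠ 0) →
      Rfun p Ψ Z bmax s n t =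
        ∑ i ∈ Finset.Icc 1 s, ∑ k ∈ Finset.range (n + 1), r i k / (t + (k : ℚ)) ^ i) :
    ∀ i ∈ Finset.Icc 2 s,
      ∃ z : ℤ, (dd n : ℚ) ^ (s - i) * (∑ k ∈ Finset.range (n + 1), r i k) = (z : ℚ) := by
  intro i hi
  have hi' : i ∈ Finset.Icc 1 s := by
    have := Finset.mem_Icc.mp hi
    exact Finset.mem_Icc.mpr ⟨by omega, this.2⟩
  have hpp : p.Prime := Fact.out
  have hc : 2 ≤ p ^ ellp p := by
    have h1 : ellp p ≠ 0 := by unfold ellp; split_ifs <;> omega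
    calc 2 ≤ p := hpp.two_le
      _ ≤ p ^ ellp p := Nat.le_self_pow h1 p
  have hΨ1 : ∀ b ∈ Ψ, 1 ≤ b := fun b hb => ((hΨ b).mp hb).1
  have hdn : ∀ b ∈ Ψ, ∀ q ∈ (p ^ ellp p * b).primeFactors, q - 1 ∣ n := by
    intro b hb q hq
    rw [mul_assoc] at hndvd
    refine (Finset.dvd_lcm (f := fun q => q - 1) ?_).trans ((Dvd.intro _ rfl).trans hndvd)
    exact Finset.mem_biUnion.mpr ⟨b, hb, hq⟩
  have hA := A_eq (p ^ ellp p) hc Ψ hΨ1 Z hZ n hdn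
  suffices H : ∀ k ∈ Finset.range (n + 1), ∃ z : ℤ, (dd n : ℚ) ^ (s - i) * r i k = z by
    choose! f hf using H
    refine ⟨∑ k ∈ Finset.range (n + 1), f k, ?_⟩
    rw [Finset.mul_sum, Int.cast_sum]
    exact Finset.sum_congr rfl hf
  intro k hk
  have hk : k ≤ n := by have := Finset.mem_range.mp hk; omega
  unfold Rfun at hr
  dsimp only at hr
  rw [hA] at hr
  have hθ : ((((p ^ ellp p * bmax : ℕ) : ℚ) - 1) / ((p ^ ellp p * bmax : ℕ) : ℚ)) ∈ Z := by
    rw [hZ]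
    have hb1 := hΨ1 bmax hbmem
    have h2 : 2 ≤ p ^ ellp p * bmax := by nlinarith
    refine ⟨p ^ ellp p * bmax - 1, bmax, hbmem, by omega, by omega, ?_, ?_⟩
    · exact (Nat.coprime_self_sub_left (by omega)).mpr (Nat.coprime_one_left _)
    · rw [Nat.cast_sub (by omega)]; simp
  have hM : (p ^ ellp p * bmax - 1) * n / (p ^ ellp p * bmax) - 1 ≤ n := by
    refine (Nat.sub_le _ _).trans (Nat.div_le_of_le_mul ?_)
    exact Nat.mul_le_mul_right _ (Nat.sub_le _ _)
  generalize (p ^ ellp p * bmax - 1) * n / (p ^ ellp p * bmax) - 1 = M at hr hM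
  generalize ((((p ^ ellp p * bmax : ℕ) : ℚ) - 1) / ((p ^ ellp p * bmax : ℕ) : ℚ)) = θm at hr hθ
  set K : ℚ := (∏ θ ∈ Z, ((θ.den : ℚ) ^ n * muu θ.den n)) *
    ((Nat.factorial n : ℚ) ^ (s - Z.card + 1) / (Nat.factorial M : ℚ)) with hK
  obtain ⟨G, hG, hGQ⟩ := SS_G n k hk
  refine extract n s k (dd n) hk
    (Polynomial.C K * (∏ j ∈ Finset.range M, (Polynomial.X + Polynomial.C (θm - k + j))) *
      ∏ θ ∈ Z.erase θm, ∏ j ∈ Finset.range n, (Polynomial.X + Polynomial.C (θ - k + j)))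
    r ?_
    ((PowerSeries.C (((θm.den : ℚ) ^ n * muu θm.den n) / M.factorial) *
      ∏ j ∈ Finset.range M, (PowerSeries.X + PowerSeries.C (θm - k + j))) *
      (∏ θ ∈ Z.erase θm, (PowerSeries.C (((θ.den : ℚ) ^ n * muu θ.den n) / n.factorial) *
      ∏ j ∈ Finset.range n, (PowerSeries.X + PowerSeries.C (θ - k + j)))) * G ^ s) ?_ ?_ i hi'
  · intro u hu
    rw [← hr (u - k) hu]
    simp only [Polynomial.eval_mul, Polynomial.eval_prod, Polynomial.eval_add,
      Polynomial.eval_X, Polynomial.eval_C]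
    have h1 : ∀ (θ : ℚ) (j : ℕ), u + (θ - k + j) = u - k + θ + j := fun θ j => by ring
    simp only [h1]
  · exact mul_mem (mul_mem (block_eq _ _ _ _ hM) (prod_mem fun θ _ => block_eq _ _ _ _ le_rfl))
      (pow_mem hG s)
  · have hcard : 1 ≤ Z.card := Finset.card_pos.mpr ⟨θm, hθ⟩
    have hKeq : K = (((θm.den : ℚ) ^ n * muu θm.den n) / M.factorial) *
        (∏ θ ∈ Z.erase θm, (((θ.den : ℚ) ^ n * muu θ.den n) / n.factorial)) * (n.factorial : ℚ) ^ s := by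
      rw [hK, ← Finset.mul_prod_erase _ _ hθ, Finset.prod_div_distrib, Finset.prod_const,
        Finset.card_erase_of_mem hθ]
      have h1 : (n.factorial : ℚ) ^ s =
          (n.factorial : ℚ) ^ (s - Z.card + 1) * (n.factorial : ℚ) ^ (Z.card - 1) := by
        rw [← pow_add]; congr 1; omega
      have h2 : (n.factorial : ℚ) ≠ 0 := by positivity
      have h3 : (n.factorial : ℚ) ^ (Z.card - 1) ≠ 0 := pow_ne_zero _ h2
      rw [h1]
      field_simp
    rw [mul_assoc, ← mul_pow, hGQ, ← Polynomial.coeToPowerSeries.ringHom_apply, map_mul, map_mul,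
      map_prod, map_prod]
    simp only [map_prod, map_add, Polynomial.coeToPowerSeries.ringHom_apply, Polynomial.coe_X,
      Polynomial.coe_C]
    rw [hKeq, map_mul, map_mul, map_prod, map_pow, Finset.prod_mul_distrib]
    ring
end

section
/- With the standing setup (prime p, l_p, B, Ψ_B, 𝒵_B, b_max, θ_max, θ_min, A_1(B), A_2(B), P_B, I, odd s, n ∈ I with l(n) = n+1 prime, the rational function R_n and its partial fraction coefficients r_{i,k}, and d_n = lcm(1,…,n)), define ρ_{0,θ_min} = −Σ_{i=1}^{s} Σ_{k=1}^{n} Σ_{ν=0}^{k−1} r_{i,k}/(ν+θ_min)^i. Then for all sufficiently large n ∈ I one has: (a) l(n)^{s} · d_n^{s} · ρ_{0,θ_min} is an integer, and (b) v_{l(n)}(ρ_{0,θ_min}) ≤ −s + |𝒵_B| − 1 (in particular ρ_{0,θ_min} ≠ 0), where v_{l(n)} is the l(n)-adic valuation on ℚ. -/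
section helpers
open Polynomial


/-- The rational numbers that are integral at `q`. -/
def Sq (q : ℕ) [Fact q.Prime] : Subring ℚ where
  carrier := {x | padicNorm q x ≤ 1}
  mul_mem' := by
    intro a b ha hb
    simp only [Set.mem_ofPred_eq] at *
    rw [padicNorm.mul]
    exact mul_le_one₀ ha (padicNorm.nonneg _) hb
  one_mem' := by simp
  add_mem' := by
    intro a b ha hb
    exact le_trans padicNorm.nonarchimedean (max_le ha hb)
  zero_mem' := by simp
  neg_mem' := by
    intro a ha
    simpa using ha

/-- Polynomials with coefficients integral at `q`. -/
noncomputable def SX (q : ℕ) [Fact q.Prime] : Subring ℚ[X] :=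
  (Polynomial.mapRingHom (Sq q).subtype).range

section basics
variable {q : ℕ} [Fact q.Prime]

lemma mem_Sq {x : ℚ} : x ∈ Sq q ↔ padicNorm q x ≤ 1 := Iff.rfl

lemma int_mem_Sq (z : ℤ) : (z : ℚ) ∈ Sq q := padicNorm.of_int z

lemma nat_mem_Sq (z : ℕ) : (z : ℚ) ∈ Sq q := padicNorm.of_nat z

lemma inv_mem_Sq {z : ℤ} (h : ¬ (q : ℤ) ∣ z) : (z : ℚ)⁻¹ ∈ Sq q := by
  rw [mem_Sq, ← one_div, padicNorm.div, padicNorm.int_eq_one_iff z |>.2 h]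
  simp

lemma inv_nat_mem_Sq {z : ℕ} (h : ¬ q ∣ z) : (z : ℚ)⁻¹ ∈ Sq q := by
  have := inv_mem_Sq (q := q) (z := (z : ℤ)) (by exact_mod_cast h)
  simpa using this

lemma div_mem_Sq_of_dvd {a b : ℤ} (h : b ∣ a) : (a : ℚ) / b ∈ Sq q := by
  obtain ⟨c, rfl⟩ := h
  by_cases hb : b = 0
  · subst hb; simpa using (Sq q).zero_mem
  · have : ((b * c : ℤ) : ℚ) / b = (c : ℚ) := by
      push_cast; field_simp
    rw [this]; exact int_mem_Sq c

lemma C_mem_SX {c : ℚ} (h : c ∈ Sq q) : C c ∈ SX q :=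
  ⟨C ⟨c, h⟩, by simp⟩

lemma X_mem_SX : (X : ℚ[X]) ∈ SX q := ⟨X, by simp⟩

lemma coeff_mem_Sq {f : ℚ[X]} (h : f ∈ SX q) (i : ℕ) : f.coeff i ∈ Sq q := by
  obtain ⟨g, rfl⟩ := h
  simp

end basics

lemma int_of_forall_Sq (x : ℚ) (h : ∀ (q : ℕ) [Fact q.Prime], x ∈ Sq q) : ∃ z : ℤ, x = z := by
  refine ⟨x.num, ?_⟩
  have : x.den = 1 := by
    by_contra hne
    obtain ⟨q, hq, hd⟩ := Nat.exists_prime_and_dvd hne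
    haveI : Fact q.Prime := ⟨hq⟩
    have h1 := h q
    have h2 := padicNorm.int_lt_one_iff (p := q) (x.den : ℤ) |>.2 (by exact_mod_cast hd)
    have h3 : padicNorm q (x.num : ℤ) = 1 := by
      rw [padicNorm.int_eq_one_iff]
      intro hn
      have := x.reduced
      have h5 : q ∣ x.num.natAbs := Int.natCast_dvd.1 hn
      have := Nat.dvd_gcd h5 hd
      rw [x.reduced] at this
      exact hq.one_lt.ne' (Nat.dvd_one.1 this)
    have h4 : x * (x.den : ℤ) = (x.num : ℤ) := by
      simpa using Rat.mul_den_eq_num x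
    have h6 := congrArg (padicNorm q) h4
    rw [padicNorm.mul, h3] at h6
    rw [mem_Sq] at h1
    have h7 := padicNorm.nonneg (p := q) x
    have h8 := padicNorm.nonneg (p := q) ((x.den : ℤ) : ℚ)
    nlinarith
  exact (Rat.den_eq_one_iff x).1 this |>.symm

/-- coefficient extraction -/
lemma coeff_extract {q : ℕ} [Fact q.Prime] (s : ℕ) (P Q T W : ℚ[X]) (hP : P ∈ SX q) (hQ : Q ∈ SX q)
    (hQ0 : Q.coeff 0 = 1) (h : P = Q * T + X ^ s * W) :
    ∀ j < s, T.coeff j ∈ Sq q := by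
  intro j
  induction j using Nat.strong_induction_on with
  | _ j ih =>
    intro hj
    have h1 : P.coeff j = (Q * T).coeff j := by
      rw [h, coeff_add, coeff_X_pow_mul']
      simp [Nat.not_le.2 hj]
    rw [coeff_mul, Finset.Nat.sum_antidiagonal_eq_sum_range_succ_mk, Finset.sum_range_succ'] at h1
    simp only [hQ0, one_mul, Nat.sub_zero] at h1
    have h2 : T.coeff j = P.coeff j - ∑ k ∈ Finset.range j, Q.coeff (k + 1) * T.coeff (j - (k + 1)) := by
      rw [h1]; ring
    rw [h2]
    refine sub_mem (coeff_mem_Sq hP j) (sum_mem fun k hk => mul_mem (coeff_mem_Sq hQ _) (ih _ ?_ ?_))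
    · have := Finset.mem_range.1 hk; omega
    · have := Finset.mem_range.1 hk; omega

/-- `(d X + α)_h / h!` -/
noncomputable def EE (d : ℚ) (h : ℕ) (α : ℚ) : ℚ[X] :=
  C ((h.factorial : ℚ)⁻¹) * ∏ j ∈ Finset.range h, (C d * X + C (α + j))

lemma EE_zero_aux (d : ℚ) (h : ℕ) :
    ∏ j ∈ Finset.range h, (C d * X + C (0 + ((j + 1 : ℕ) : ℚ))) =
      C (h.factorial : ℚ) * ∏ j ∈ Finset.range h, (C (d / ((j + 1 : ℕ) : ℚ)) * X + 1) := by
  induction h with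
  | zero => simp
  | succ h ih =>
    rw [Finset.prod_range_succ, ih, Finset.prod_range_succ, Nat.factorial_succ]
    have : C d * X + C (0 + ((h + 1 : ℕ) : ℚ)) =
        C ((h + 1 : ℕ) : ℚ) * (C (d / ((h + 1 : ℕ) : ℚ)) * X + 1) := by
      rw [mul_add, ← mul_assoc, ← C_mul]
      have : ((h + 1 : ℕ) : ℚ) ≠ 0 := by positivity
      rw [mul_div_cancel₀ _ this]; simp
    rw [this, Nat.cast_mul, C_mul]
    ring

lemma EE_pascal (d : ℚ) (h : ℕ) (α : ℚ) :
    EE d (h + 1) (α + 1) = EE d (h + 1) α + EE d h (α + 1) := by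
  unfold EE
  have h1 : ∏ j ∈ Finset.range (h + 1), (C d * X + C (α + (j : ℚ))) =
      (∏ j ∈ Finset.range h, (C d * X + C (α + 1 + (j : ℚ)))) * (C d * X + C α) := by
    rw [Finset.prod_range_succ']
    congr 1
    · refine Finset.prod_congr rfl fun j _ => ?_
      congr 2; push_cast; ring
    · simp
  rw [h1, Finset.prod_range_succ, Nat.factorial_succ]
  have h2 : C ((h.factorial : ℚ)⁻¹) = C ((((h + 1) * h.factorial : ℕ) : ℚ)⁻¹) * C ((h : ℚ) + 1) := by
    rw [← C_mul]; congr 1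
    have : (h.factorial : ℚ) ≠ 0 := by positivity
    have : (h : ℚ) + 1 ≠ 0 := by positivity
    push_cast; field_simp
  rw [h2]
  simp only [C_add, C_1]
  ring

lemma EE_nat_mem {q : ℕ} [Fact q.Prime] (d n : ℕ) (hd : ∀ j, 1 ≤ j → j ≤ n → j ∣ d) (a : ℕ) :
    ∀ h ≤ n, EE d h a ∈ SX q := by
  have hdm : ∀ j : ℕ, j + 1 ≤ n → (d : ℚ) / ((j + 1 : ℕ) : ℚ) ∈ Sq q := by
    intro j hj
    have := div_mem_Sq_of_dvd (q := q) (a := d) (b := (j + 1 : ℕ))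
      (by exact_mod_cast hd (j + 1) (by omega) hj)
    simpa using this
  induction a with
  | zero =>
    intro h hh
    cases h with
    | zero => simpa [EE] using (SX q).one_mem
    | succ h =>
      have h1 : EE d (h + 1) ((0 : ℕ) : ℚ) = C ((d : ℚ) / ((h + 1 : ℕ) : ℚ)) * X *
          ∏ j ∈ Finset.range h, (C ((d : ℚ) / ((j + 1 : ℕ) : ℚ)) * X + 1) := by
        unfold EE
        rw [Finset.prod_range_succ', Nat.cast_zero, EE_zero_aux]
        have : C ((d : ℚ) / ((h + 1 : ℕ) : ℚ)) =
            C ((((h + 1).factorial : ℕ) : ℚ)⁻¹) * C (h.factorial : ℚ) * C (d : ℚ) := by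
          rw [← C_mul, ← C_mul]; congr 1
          rw [Nat.factorial_succ]
          have : (h.factorial : ℚ) ≠ 0 := by positivity
          have : (h : ℚ) + 1 ≠ 0 := by positivity
          push_cast; field_simp
        rw [this]
        simp only [Nat.cast_zero, add_zero, C_0]
        ring
      rw [h1]
      refine mul_mem (mul_mem (C_mem_SX (hdm h hh)) X_mem_SX) (prod_mem fun j hj => ?_)
      have := Finset.mem_range.1 hj
      exact add_mem (mul_mem (C_mem_SX (hdm j (by omega))) X_mem_SX) (SX q).one_mem
  | succ a ih =>
    intro h
    induction h with
    | zero => intro _; simpa [EE] using (SX q).one_mem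
    | succ h ih2 =>
      intro hh
      have := EE_pascal (d : ℚ) h a
      push_cast at *
      rw [this]
      exact add_mem (ih _ hh) (ih2 (by omega))

lemma padicNorm_pow_aux {q : ℕ} [Fact q.Prime] (x : ℚ) (e : ℕ) :
    padicNorm q (x ^ e) = padicNorm q x ^ e := by
  induction e with
  | zero => simp
  | succ e ih => rw [pow_succ, padicNorm.mul, ih, pow_succ]

lemma pow_div_factorial_mem {q : ℕ} [Fact q.Prime] (h e : ℕ) (he : h / (q - 1) ≤ e) :
    (q : ℚ) ^ e / (h.factorial : ℚ) ∈ Sq q := by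
  have hq : q.Prime := Fact.out
  have h1 := sub_one_mul_padicValNat_factorial (p := q) h
  have h2 : padicValNat q h.factorial ≤ e := by
    refine le_trans ?_ he
    rw [Nat.le_div_iff_mul_le (by have := hq.two_le; omega), mul_comm, h1]
    omega
  have hne : (h.factorial : ℚ) ≠ 0 := by positivity
  rw [mem_Sq, padicNorm.div, padicNorm.eq_zpow_of_nonzero hne]
  rw [div_le_one (by have := hq.pos; positivity), padicNorm_pow_aux]
  rw [padicNorm.padicNorm_p hq.one_lt]
  rw [padicValRat.of_nat, zpow_neg, inv_pow, zpow_natCast]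
  have : (1 : ℚ) ≤ q := by exact_mod_cast hq.one_lt.le
  gcongr

lemma EE_mem_of_coprime {q : ℕ} [Fact q.Prime] (d n : ℕ) (hd : ∀ j, 1 ≤ j → j ≤ n → j ∣ d)
    (D : ℕ) (hD : ¬ q ∣ D) (a : ℤ) (h : ℕ) (hh : h ≤ n) : EE d h ((a : ℚ) / D) ∈ SX q := by
  have hq : q.Prime := Fact.out
  have hD0 : D ≠ 0 := by rintro rfl; simp at hD
  -- choose natural number approximating
  obtain ⟨a', z, ha'⟩ : ∃ (a' : ℕ) (z : ℤ), a - D * a' = q ^ h * z := by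
    have hcop : IsCoprime (D : ℤ) ((q : ℤ) ^ h) := by
      have : Nat.Coprime D (q ^ h) :=
        (Nat.Coprime.pow_left h ((Nat.Prime.coprime_iff_not_dvd hq).2 hD)).symm
      have := Nat.isCoprime_iff_coprime.2 this
      simpa using this
    obtain ⟨u, v, huv⟩ := hcop
    have hqh : (0 : ℤ) < (q : ℤ) ^ h := by have := hq.pos; positivity
    refine ⟨((a * u) % (q ^ h : ℤ)).toNat, a * v + D * ((a * u) / (q ^ h : ℤ)), ?_⟩
    rw [Int.toNat_of_nonneg (Int.emod_nonneg _ hqh.ne'), Int.emod_def]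
    linear_combination (-a) * huv
  have hDq : (D : ℚ) ≠ 0 := by exact_mod_cast hD0
  have hf : (h.factorial : ℚ) ≠ 0 := by positivity
  set β : ℚ := ((a : ℚ) / D - a') / h.factorial with hβ
  have hβm : β ∈ Sq q := by
    have : β = (D : ℚ)⁻¹ * z * ((q : ℚ) ^ h / h.factorial) := by
      rw [hβ]
      have : (a : ℚ) - D * a' = q ^ h * z := by exact_mod_cast ha'
      field_simp
      linear_combination this
    rw [this]
    exact mul_mem (mul_mem (inv_nat_mem_Sq hD) (int_mem_Sq z))
      (pow_div_factorial_mem h h (Nat.div_le_self _ _))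
  have hα : (a : ℚ) / D = a' + h.factorial * β := by rw [hβ]; field_simp; ring
  -- difference of products
  have key : ∀ g : ℕ, ∃ V ∈ SX q, ∏ j ∈ Finset.range g, (C (d : ℚ) * X + C ((a : ℚ) / D + j)) =
      ∏ j ∈ Finset.range g, (C (d : ℚ) * X + C ((a' : ℚ) + j)) + C (h.factorial : ℚ) * V := by
    intro g
    induction g with
    | zero => exact ⟨0, zero_mem _, by simp⟩
    | succ g ih =>
      obtain ⟨V, hV, hV2⟩ := ih
      refine ⟨V * (C (d : ℚ) * X + C ((a' : ℚ) + (g : ℚ)) + C (h.factorial * β)) +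
        C β * ∏ j ∈ Finset.range g, (C (d : ℚ) * X + C ((a' : ℚ) + j)), ?_, ?_⟩
      · have hlin : ∀ j : ℕ, C (d : ℚ) * X + C ((a' : ℚ) + (j : ℚ)) ∈ SX q := fun j =>
          add_mem (mul_mem (C_mem_SX (nat_mem_Sq d)) X_mem_SX)
            (C_mem_SX (add_mem (nat_mem_Sq a') (nat_mem_Sq j)))
        exact add_mem (mul_mem hV (add_mem (hlin g) (C_mem_SX (mul_mem (nat_mem_Sq _) hβm))))
          (mul_mem (C_mem_SX hβm) (prod_mem fun j _ => hlin j))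
      · rw [Finset.prod_range_succ, hV2, Finset.prod_range_succ, hα]
        simp only [C_add, C_mul]
        ring
  obtain ⟨V, hV, hV2⟩ := key h
  have : EE d h ((a : ℚ) / D) = EE d h a' + V := by
    unfold EE
    rw [hV2, mul_add, ← mul_assoc, ← C_mul, inv_mul_cancel₀ hf]; simp
  rw [this]
  exact add_mem (EE_nat_mem d n hd a' h hh) hV

/-- The denominator factor attached to a fraction with denominator `D`. -/
def alphaD (D n : ℕ) : ℕ := D ^ n * ∏ q ∈ D.primeFactors, q ^ (n / (q - 1))

lemma alphaD_EE_mem {q : ℕ} [Fact q.Prime] (d n : ℕ) (hd : ∀ j, 1 ≤ j → j ≤ n → j ∣ d)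
    (D : ℕ) (hD0 : D ≠ 0) (a : ℤ) (h : ℕ) (hh : h ≤ n) :
    C (alphaD D n : ℚ) * EE d h ((a : ℚ) / D) ∈ SX q := by
  by_cases hD : q ∣ D
  · have hDq : (D : ℚ) ≠ 0 := by exact_mod_cast hD0
    have hmem : q ∈ D.primeFactors := by
      rw [Nat.mem_primeFactors]; exact ⟨Fact.out, hD, hD0⟩
    have h1 : C (alphaD D n : ℚ) * EE d h ((a : ℚ) / D) =
        C (((D ^ (n - h) * ∏ q' ∈ D.primeFactors.erase q, q' ^ (n / (q' - 1)) : ℕ)) : ℚ) *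
        C ((q : ℚ) ^ (n / (q - 1)) / h.factorial) *
        ∏ j ∈ Finset.range h, (C ((D * d : ℕ) : ℚ) * X + C ((a + D * j : ℤ) : ℚ)) := by
      have h2 : ∏ j ∈ Finset.range h, (C ((D * d : ℕ) : ℚ) * X + C ((a + D * j : ℤ) : ℚ)) =
          C ((D : ℚ) ^ h) * ∏ j ∈ Finset.range h, (C (d : ℚ) * X + C ((a : ℚ) / D + j)) := by
        rw [C_pow]
        conv_rhs => rw [← Finset.card_range h, ← Finset.prod_const, Finset.card_range,
          ← Finset.prod_mul_distrib]
        refine Finset.prod_congr rfl fun j _ => ?_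
        rw [mul_add, ← mul_assoc, ← C_mul, ← C_mul]
        congr 2
        · push_cast; ring
        · push_cast; field_simp
      rw [h2]
      unfold EE
      rw [← mul_assoc, ← mul_assoc, ← C_mul, ← C_mul, ← C_mul]
      congr 2
      unfold alphaD
      rw [← Finset.mul_prod_erase _ _ hmem]
      have : D ^ n = D ^ (n - h) * D ^ h := by rw [← pow_add]; congr 1; omega
      rw [this]
      push_cast
      ring
    rw [h1]
    refine mul_mem (mul_mem (C_mem_SX (nat_mem_Sq _)) (C_mem_SX (pow_div_factorial_mem _ _
      (Nat.div_le_div_right hh)))) (prod_mem fun j _ => ?_)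
    exact add_mem (mul_mem (C_mem_SX (nat_mem_Sq _)) X_mem_SX) (C_mem_SX (int_mem_Sq _))
  · exact mul_mem (C_mem_SX (nat_mem_Sq _)) (EE_mem_of_coprime d n hd D hD a h hh)

/-- `n! / ∏_{j ≠ k} (j - k)` is an integer. -/
lemma prod_sub_eq (n k : ℕ) (hk : k ≤ n) :
    ∏ j ∈ (Finset.range (n + 1)).erase k, ((j : ℚ) - k) =
      (-1) ^ k * (k.factorial : ℚ) * ((n - k).factorial : ℚ) := by
  obtain ⟨m, rfl⟩ := Nat.exists_eq_add_of_le hk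
  have hsplit : (Finset.range (k + m + 1)).erase k =
      Finset.range k ∪ (Finset.range m).image (fun i => k + 1 + i) := by
    ext j
    simp only [Finset.mem_erase, Finset.mem_range, Finset.mem_union, Finset.mem_image]
    constructor
    · rintro ⟨h1, h2⟩
      rcases lt_or_gt_of_ne h1 with h | h
      · exact Or.inl h
      · exact Or.inr ⟨j - (k + 1), by omega, by omega⟩
    · rintro (h | ⟨i, hi, rfl⟩) <;> omega
  have hdisj : Disjoint (Finset.range k) ((Finset.range m).image (fun i => k + 1 + i)) := by
    rw [Finset.disjoint_left]
    intro j hj hj2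
    simp only [Finset.mem_range, Finset.mem_image] at hj hj2
    obtain ⟨i, _, rfl⟩ := hj2
    omega
  rw [hsplit, Finset.prod_union hdisj, Finset.prod_image (by intro x _ y _ h; simpa using h)]
  congr 1
  · rw [← Finset.prod_range_reflect]
    rw [← Finset.prod_range_add_one_eq_factorial]
    push_cast
    conv_rhs => rw [← Finset.card_range k, ← Finset.prod_const, Finset.card_range,
          ← Finset.prod_mul_distrib]
    refine Finset.prod_congr rfl fun j hj => ?_
    have := Finset.mem_range.1 hj
    have h3 : ((k - 1 - j : ℕ) : ℚ) = (k : ℚ) - 1 - j := by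
      rw [Nat.cast_sub (by omega), Nat.cast_sub (by omega)]; simp
    rw [h3]; ring
  · rw [Nat.add_sub_cancel_left, ← Finset.prod_range_add_one_eq_factorial]
    push_cast
    refine Finset.prod_congr rfl fun j hj => ?_
    ring

lemma fact_div_prod_mem {q : ℕ} [Fact q.Prime] (n k : ℕ) (hk : k ≤ n) :
    (n.factorial : ℚ) / ∏ j ∈ (Finset.range (n + 1)).erase k, ((j : ℚ) - k) ∈ Sq q := by
  rw [prod_sub_eq n k hk]
  have : (n.factorial : ℚ) / ((-1) ^ k * (k.factorial : ℚ) * ((n - k).factorial : ℚ)) =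
      (((-1) ^ k * (n.choose k : ℤ) : ℤ) : ℚ) := by
    have h := Nat.choose_mul_factorial_mul_factorial hk
    have h' : (n.choose k : ℚ) * k.factorial * (n - k).factorial = n.factorial := by
      exact_mod_cast h
    rw [← h']
    have : (k.factorial : ℚ) ≠ 0 := by positivity
    have : ((n - k).factorial : ℚ) ≠ 0 := by positivity
    have h1 : ((-1 : ℚ) ^ k) * (-1) ^ k = 1 := by rw [← mul_pow]; simp
    have : ((-1 : ℚ) ^ k) ≠ 0 := by positivity
    push_cast
    field_simp
    linear_combination -(n.choose k : ℚ) * h1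
  rw [this]
  exact int_mem_Sq _

/-- Denominator bound for the partial fraction coefficients. -/
lemma coef_mem {q : ℕ} [Fact q.Prime] (n s d k : ℕ) (hk : k ≤ n) (hd0 : d ≠ 0)
    (hd : ∀ j, 1 ≤ j → j ≤ n → j ∣ d) (U R : ℚ → ℚ)
    (hR : ∀ t, R t = U t / (∏ j ∈ Finset.range (n + 1), (t + (j : ℚ))) ^ s)
    (r : ℕ → ℕ → ℚ)
    (hr : ∀ t : ℚ, (∀ j ∈ Finset.range (n + 1), t + (j : ℚ) ≠ 0) →
          R t = ∑ i ∈ Finset.Icc 1 s, ∑ k ∈ Finset.range (n + 1), r i k / (t + (k : ℚ)) ^ i)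
    (P : ℚ[X]) (hP : P ∈ SX q)
    (hPU : ∀ x, P.eval x = U (-k + d * x) /
      (∏ j ∈ (Finset.range (n + 1)).erase k, ((j : ℚ) - k)) ^ s) :
    ∀ i ∈ Finset.Icc 1 s, (d : ℚ) ^ (s - i) * r i k ∈ Sq q := by
  have hkr : k ∈ Finset.range (n + 1) := Finset.mem_range.2 (by omega)
  set J := (Finset.range (n + 1)).erase k with hJ
  set c : ℕ → ℚ := fun j => (d : ℚ) / ((j : ℚ) - k) with hc
  have hjk : ∀ j ∈ J, (j : ℚ) - k ≠ 0 := by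
    intro j hj h
    rw [sub_eq_zero] at h
    exact (Finset.mem_erase.1 hj).1 (by exact_mod_cast h)
  have hlin : ∀ j ∈ J, ∀ x : ℚ, (j : ℚ) - k + d * x = ((j : ℚ) - k) * (1 + c j * x) := by
    intro j hj x
    have := hjk j hj
    simp only [hc]; field_simp
  have hcm : ∀ j ∈ J, c j ∈ Sq q := by
    intro j hj
    have h1 := Finset.mem_erase.1 hj
    have h2 := Finset.mem_range.1 h1.2
    have := div_mem_Sq_of_dvd (q := q) (a := d) (b := (j : ℤ) - k) (by
      rw [← Int.natAbs_dvd]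
      exact Int.natCast_dvd_natCast.2 (hd ((j : ℤ) - k).natAbs (by omega) (by omega)))
    push_cast at this
    exact this
  set Q : ℚ[X] := (∏ j ∈ J, (1 + C (c j) * X)) ^ s with hQ
  have hQm : Q ∈ SX q := pow_mem (prod_mem fun j hj =>
    add_mem (one_mem _) (mul_mem (C_mem_SX (hcm j hj)) X_mem_SX)) _
  have hQ0 : Q.coeff 0 = 1 := by
    rw [coeff_zero_eq_eval_zero, hQ]; simp [eval_prod]
  have hQe : ∀ x, Q.eval x * (∏ j ∈ J, ((j : ℚ) - k)) ^ s = (∏ j ∈ J, ((j : ℚ) - k + d * x)) ^ s := by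
    intro x
    rw [hQ, eval_pow, eval_prod, ← mul_pow, ← Finset.prod_mul_distrib]
    congr 1
    refine Finset.prod_congr rfl fun j hj => ?_
    rw [hlin j hj]; simp; ring
  -- polynomial quotients
  have hW : ∀ i k' : ℕ, ∃ w : ℚ[X], i ∈ Finset.Icc 1 s → k' ∈ J → ∀ x : ℚ,
      (k' : ℚ) - k + d * x ≠ 0 → w.eval x = Q.eval x * (r i k' / ((k' : ℚ) - k + d * x) ^ i) := by
    intro i k'
    by_cases h : i ∈ Finset.Icc 1 s ∧ k' ∈ J
    · obtain ⟨hi, hk'⟩ := h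
      have : (1 + C (c k') * X) ^ i ∣ Q := by
        rw [hQ]
        exact (pow_dvd_pow _ (Finset.mem_Icc.1 hi).2).trans
          (pow_dvd_pow_of_dvd (Finset.dvd_prod_of_mem (fun j => 1 + C (c j) * X) hk') s)
      obtain ⟨w, hw⟩ := this
      refine ⟨C (r i k' / ((k' : ℚ) - k) ^ i) * w, fun _ _ x hx => ?_⟩
      rw [hlin k' hk'] at hx ⊢
      rw [hw]
      have h1 := left_ne_zero_of_mul hx
      have h2 := right_ne_zero_of_mul hx
      simp only [eval_mul, eval_C, eval_pow, eval_add, eval_one, eval_X]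
      rw [mul_pow]
      field_simp
    · exact ⟨0, fun h1 h2 => absurd ⟨h1, h2⟩ h⟩
  choose w hw using hW
  set T : ℚ[X] := ∑ i ∈ Finset.Icc 1 s, C ((d : ℚ) ^ (s - i) * r i k) * X ^ (s - i) with hT
  set W : ℚ[X] := C ((d : ℚ) ^ s) * ∑ i ∈ Finset.Icc 1 s, ∑ k' ∈ J, w i k' with hWd
  have hmain : P = Q * T + X ^ s * W := by
    refine Polynomial.eq_of_infinite_eval_eq _ _ ?_
    refine Set.infinite_of_injective_forall_mem (f := fun i : ℕ => ((n + 1 + i : ℕ) : ℚ)) ?_ ?_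
    · intro a b h
      have h' : ((n + 1 + a : ℕ) : ℚ) = ((n + 1 + b : ℕ) : ℚ) := h
      have : n + 1 + a = n + 1 + b := by exact_mod_cast h'
      omega
    · intro i0
      simp only [Set.mem_ofPred_eq]
      set x : ℚ := ((n + 1 + i0 : ℕ) : ℚ) with hx
      have hd1 : (1 : ℚ) ≤ d := by exact_mod_cast Nat.one_le_iff_ne_zero.2 hd0
      have hxn : (n : ℚ) + 1 ≤ x := by rw [hx]; push_cast; linarith [(Nat.cast_nonneg i0 : (0:ℚ) ≤ i0)]
      have hkn : (k : ℚ) ≤ n := by exact_mod_cast hk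
      have hn0 : (0 : ℚ) ≤ n := Nat.cast_nonneg n
      have hdx : (n : ℚ) + 1 ≤ d * x := by nlinarith
      have hpos : ∀ j : ℕ, (0 : ℚ) < (j : ℚ) - k + d * x := by
        intro j
        have : (0 : ℚ) ≤ j := Nat.cast_nonneg j
        linarith
      have hr1 := hr (-k + d * x) (by
        intro j _
        have := (hpos j).ne'
        intro h; apply this; rw [← h]; ring)
      have hdx0 : (d : ℚ) * x ≠ 0 := by have : (0 : ℚ) < d * x := by linarith
                                        exact this.ne'
      have hx0 : x ≠ 0 := right_ne_zero_of_mul hdx0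
      have hPr : ∏ j ∈ Finset.range (n + 1), (-(k : ℚ) + d * x + (j : ℚ)) =
          (d * x) * ∏ j ∈ J, ((j : ℚ) - k + d * x) := by
        rw [← Finset.mul_prod_erase _ _ hkr]
        congr 1
        · ring
        · exact Finset.prod_congr rfl fun j _ => by ring
      have hN1 : (∏ j ∈ J, ((j : ℚ) - k)) ^ s ≠ 0 :=
        pow_ne_zero _ (Finset.prod_ne_zero_iff.2 hjk)
      have hN2 : (∏ j ∈ J, ((j : ℚ) - k + d * x)) ^ s ≠ 0 :=
        pow_ne_zero _ (Finset.prod_ne_zero_iff.2 fun j _ => (hpos j).ne')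
      have hPe : P.eval x = R (-k + d * x) * (d * x) ^ s * Q.eval x := by
        rw [hPU, hR, hPr, mul_pow, div_eq_iff hN1]
        rw [mul_assoc, hQe]
        field_simp
      have hsum : ∑ i ∈ Finset.Icc 1 s, ∑ k' ∈ Finset.range (n + 1), r i k' / (-(k : ℚ) + d * x + (k' : ℚ)) ^ i
          = ∑ i ∈ Finset.Icc 1 s, (r i k / (d * x) ^ i + ∑ k' ∈ J, r i k' / ((k' : ℚ) - k + d * x) ^ i) := by
        refine Finset.sum_congr rfl fun i _ => ?_
        rw [← Finset.add_sum_erase _ _ hkr]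
        congr 1
        · congr 2; ring
        · exact Finset.sum_congr rfl fun j _ => by congr 2; ring
      rw [hPe, hr1, hsum, Finset.sum_add_distrib, add_mul, add_mul, eval_add, eval_mul]
      congr 1
      · rw [mul_comm]
        congr 1
        rw [hT, eval_finsetSum, Finset.sum_mul]
        refine Finset.sum_congr rfl fun i hi => ?_
        have : (d * x) ^ s = (d * x) ^ (s - i) * (d * x) ^ i := by
          rw [← pow_add]; congr 1; have := (Finset.mem_Icc.1 hi).2; omega
        rw [this]
        have := pow_ne_zero i hdx0
        simp only [eval_mul, eval_C, eval_pow, eval_X]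
        rw [mul_pow _ _ (s - i)]
        field_simp
      · have hXs : eval x (X ^ s : ℚ[X]) = x ^ s := by simp
        rw [hWd, eval_mul, eval_mul, eval_C, hXs, eval_finsetSum]
        have : ∀ i ∈ Finset.Icc 1 s, (∑ k' ∈ J, w i k').eval x =
            Q.eval x * ∑ k' ∈ J, r i k' / ((k' : ℚ) - k + d * x) ^ i := by
          intro i hi
          rw [eval_finsetSum, Finset.mul_sum]
          exact Finset.sum_congr rfl fun k' hk' => hw i k' hi hk' x (hpos k').ne'
        rw [Finset.sum_congr rfl this, ← Finset.mul_sum]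
        ring
  intro i hi
  have hi' := Finset.mem_Icc.1 hi
  have := coeff_extract s P Q T W hP hQm hQ0 hmain (s - i) (by omega)
  have h2 : T.coeff (s - i) = (d : ℚ) ^ (s - i) * r i k := by
    rw [hT, finset_sum_coeff, Finset.sum_eq_single i]
    · rw [coeff_C_mul, coeff_X_pow, if_pos rfl, mul_one]
    · intro b hb hne
      have := Finset.mem_Icc.1 hb
      rw [coeff_C_mul, coeff_X_pow, if_neg (by omega), mul_zero]
    · exact fun h => absurd hi h
  rwa [h2] at this

lemma reindex_sum (n s : ℕ) (r : ℕ → ℕ → ℚ) (θ : ℚ) :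
    ∑ i ∈ Finset.Icc 1 s, ∑ k ∈ Finset.Icc 1 n, ∑ ν ∈ Finset.range k, r i k / ((ν : ℚ) + θ) ^ i =
    ∑ u ∈ Finset.Icc 1 n, ∑ k ∈ Finset.Icc u n, ∑ i ∈ Finset.Icc 1 s,
      r i k / ((k : ℚ) - u + θ) ^ i := by
  rw [Finset.sum_comm]
  have h1 : ∀ k ∈ Finset.Icc 1 n, ∑ i ∈ Finset.Icc 1 s, ∑ ν ∈ Finset.range k, r i k / ((ν : ℚ) + θ) ^ i
      = ∑ u ∈ Finset.Icc 1 k, ∑ i ∈ Finset.Icc 1 s, r i k / ((k : ℚ) - u + θ) ^ i := by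
    intro k _
    rw [Finset.sum_comm]
    refine Finset.sum_nbij' (fun ν => k - ν) (fun u => k - u) ?_ ?_ ?_ ?_ ?_
    · intro a ha; have := Finset.mem_range.1 ha; simp only [Finset.mem_Icc]; omega
    · intro a ha; have := Finset.mem_Icc.1 ha; simp only [Finset.mem_range]; omega
    · intro a ha; have := Finset.mem_range.1 ha; omega
    · intro a ha; have := Finset.mem_Icc.1 ha; omega
    · intro a ha
      have := Finset.mem_range.1 ha
      refine Finset.sum_congr rfl fun i _ => ?_
      rw [Nat.cast_sub this.le]
      congr 3; ring
  rw [Finset.sum_congr rfl h1]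
  refine Finset.sum_comm' ?_
  intro x y
  simp only [Finset.mem_Icc]
  omega

lemma term_mem {q : ℕ} [Fact q.Prime] (s d e : ℕ) (r : ℕ → ℚ) (x : ℚ)
    (hr : ∀ i ∈ Finset.Icc 1 s, (d : ℚ) ^ (s - i) * r i ∈ Sq q)
    (hx : (e * d : ℚ) / x ∈ Sq q) :
    (e : ℚ) ^ s * (d : ℚ) ^ s * ∑ i ∈ Finset.Icc 1 s, r i / x ^ i ∈ Sq q := by
  rw [Finset.mul_sum]
  refine sum_mem fun i hi => ?_
  have hi' := Finset.mem_Icc.1 hi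
  have h1 : (d : ℚ) ^ s = d ^ (s - i) * d ^ i := by rw [← pow_add]; congr 1; omega
  have h2 : (e : ℚ) ^ s = e ^ (s - i) * e ^ i := by rw [← pow_add]; congr 1; omega
  have : (e : ℚ) ^ s * (d : ℚ) ^ s * (r i / x ^ i) =
      e ^ (s - i) * (d ^ (s - i) * r i) * (e * d / x) ^ i := by
    rw [h1, h2, div_pow, mul_pow]; ring
  rw [this]
  exact mul_mem (mul_mem (pow_mem (nat_mem_Sq e) _) (hr i hi)) (pow_mem hx _)

lemma bad_unique {q : ℕ} [Fact q.Prime] (n d : ℕ) (hd0 : d ≠ 0)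
    (hd : ∀ j, 1 ≤ j → j ≤ n → j ∣ d) (y : ℚ)
    (k k' : ℕ) (hk : k ≤ n) (hk' : k' ≤ n) (hne : k ≠ k')
    (hy : (k : ℚ) + y ≠ 0) (hy' : (k' : ℚ) + y ≠ 0)
    (hbad : (d : ℚ) / (k + y) ∉ Sq q) : (d : ℚ) / (k' + y) ∈ Sq q := by
  by_contra hbad'
  have hdq : (d : ℚ) ≠ 0 := by exact_mod_cast hd0
  have key : ∀ z : ℚ, z ≠ 0 → (d : ℚ) / z ∉ Sq q → padicNorm q (z / d) < 1 := by
    intro z hz h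
    rw [mem_Sq, not_le] at h
    have h1 : padicNorm q (d / z) * padicNorm q (z / d) = 1 := by
      rw [← padicNorm.mul]
      have : (d : ℚ) / z * (z / d) = 1 := by field_simp
      rw [this]; simp
    have := padicNorm.nonneg (p := q) (z / d)
    by_contra hcon
    nlinarith
  have h1 := key _ hy hbad
  have h2 := key _ hy' hbad'
  have h3 : padicNorm q (((k : ℚ) - k') / d) < 1 := by
    have : ((k : ℚ) - k') / d = (k + y) / d - (k' + y) / d := by ring
    rw [this]
    exact lt_of_le_of_lt padicNorm.sub (max_lt h1 h2)
  have h4 : (d : ℚ) / ((k : ℚ) - k') ∈ Sq q := by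
    have := div_mem_Sq_of_dvd (q := q) (a := d) (b := (k : ℤ) - k') (by
      rw [← Int.natAbs_dvd]
      exact Int.natCast_dvd_natCast.2 (hd ((k : ℤ) - k').natAbs (by omega) (by omega)))
    push_cast at this
    exact this
  have hkk : (k : ℚ) - k' ≠ 0 := by
    rw [sub_ne_zero]; exact_mod_cast hne
  rw [mem_Sq] at h4
  have h5 : padicNorm q (d / ((k : ℚ) - k')) * padicNorm q (((k : ℚ) - k') / d) = 1 := by
    rw [← padicNorm.mul]
    have : (d : ℚ) / ((k : ℚ) - k') * (((k : ℚ) - k') / d) = 1 := by field_simp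
    rw [this]; simp
  have := padicNorm.nonneg (p := q) (d / ((k : ℚ) - k'))
  have := padicNorm.nonneg (p := q) (((k : ℚ) - k') / d)
  nlinarith

lemma int_add_inv_ne (N : ℕ) (hN : 2 ≤ N) (z : ℤ) : (z : ℚ) + 1 / (N : ℚ) ≠ 0 := by
  intro h
  have hN0 : (N : ℚ) ≠ 0 := by positivity
  have h1 : ((z * N + 1 : ℤ) : ℚ) = 0 := by
    push_cast
    field_simp at h
    linarith
  have h2 : z * N + 1 = 0 := by exact_mod_cast h1
  have : (N : ℤ) ∣ 1 := ⟨-z, by linarith⟩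
  have := Int.le_of_dvd one_pos this
  omega

section core
variable (n s d N c m : ℕ) (R : ℚ → ℚ) (r : ℕ → ℕ → ℚ)

/-- If some `k ≥ u` is bad then the tail sum agrees with `R` up to integral terms. -/
lemma swap_mem {q : ℕ} [Fact q.Prime] (hd0 : d ≠ 0) (hN : 2 ≤ N)
    (hd : ∀ j, 1 ≤ j → j ≤ n → j ∣ d)
    (hr : ∀ t : ℚ, (∀ j ∈ Finset.range (n + 1), t + (j : ℚ) ≠ 0) →
          R t = ∑ i ∈ Finset.Icc 1 s, ∑ k ∈ Finset.range (n + 1), r i k / (t + (k : ℚ)) ^ i)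
    (hcoef : ∀ k ≤ n, ∀ i ∈ Finset.Icc 1 s, (d : ℚ) ^ (s - i) * r i k ∈ Sq q)
    (u : ℕ) (hu : u ≤ n)
    (hbad : ∃ k ∈ Finset.Icc u n, (d : ℚ) / (k - u + 1 / (N : ℚ)) ∉ Sq q) :
    (d : ℚ) ^ s * (∑ k ∈ Finset.Icc u n, ∑ i ∈ Finset.Icc 1 s, r i k / ((k : ℚ) - u + 1 / (N : ℚ)) ^ i
      - R (-u + 1 / (N : ℚ))) ∈ Sq q := by
  obtain ⟨k0, hk0, hbad⟩ := hbad
  have hk0' := Finset.mem_Icc.1 hk0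
  have hne : ∀ k : ℕ, (k : ℚ) + (-u + 1 / (N : ℚ)) ≠ 0 := by
    intro k
    have := int_add_inv_ne N hN ((k : ℤ) - u)
    push_cast at this
    intro h; apply this; rw [← h]; ring
  have h1 := hr (-u + 1 / (N : ℚ)) (by
    intro j _ h; apply hne j; rw [← h]; ring)
  have hsplit : Finset.range (n + 1) = Finset.range u ∪ Finset.Icc u n := by
    ext j; simp only [Finset.mem_range, Finset.mem_union, Finset.mem_Icc]; omega
  have hdisj : Disjoint (Finset.range u) (Finset.Icc u n) := by
    rw [Finset.disjoint_left]; intro j h1 h2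
    simp only [Finset.mem_range, Finset.mem_Icc] at h1 h2; omega
  have h2 : ∑ k ∈ Finset.Icc u n, ∑ i ∈ Finset.Icc 1 s, r i k / ((k : ℚ) - u + 1 / (N : ℚ)) ^ i
      - R (-u + 1 / (N : ℚ)) =
      - ∑ k ∈ Finset.range u, ∑ i ∈ Finset.Icc 1 s, r i k / ((k : ℚ) - u + 1 / (N : ℚ)) ^ i := by
    rw [h1, Finset.sum_comm (s := Finset.Icc 1 s), hsplit, Finset.sum_union hdisj]
    have h3 : ∀ A : Finset ℕ, ∑ k ∈ A, ∑ i ∈ Finset.Icc 1 s, r i k / (-(u : ℚ) + 1 / (N : ℚ) + k) ^ i =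
        ∑ k ∈ A, ∑ i ∈ Finset.Icc 1 s, r i k / ((k : ℚ) - u + 1 / (N : ℚ)) ^ i := by
      intro A
      refine Finset.sum_congr rfl fun k _ => Finset.sum_congr rfl fun i _ => ?_
      congr 2; ring
    rw [h3, h3]; ring
  rw [h2, mul_neg]
  refine neg_mem ?_
  rw [Finset.mul_sum]
  refine sum_mem fun k hk => ?_
  have hk' := Finset.mem_range.1 hk
  have := bad_unique (q := q) n d hd0 hd (-u + 1 / (N : ℚ)) k0 k (by omega) (by omega) (by omega)
    (hne _) (hne _) (by convert hbad using 3; ring)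
  have := term_mem (q := q) s d 1 (fun i => r i k) ((k : ℚ) - u + 1 / (N : ℚ)) (hcoef k (by omega))
    (by convert this using 2 <;> push_cast <;> ring)
  simpa using this

lemma tail_mem_of_zero {q : ℕ} [Fact q.Prime] (hd0 : d ≠ 0) (hN : 2 ≤ N)
    (hd : ∀ j, 1 ≤ j → j ≤ n → j ∣ d)
    (hr : ∀ t : ℚ, (∀ j ∈ Finset.range (n + 1), t + (j : ℚ) ≠ 0) →
          R t = ∑ i ∈ Finset.Icc 1 s, ∑ k ∈ Finset.range (n + 1), r i k / (t + (k : ℚ)) ^ i)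
    (hcoef : ∀ k ≤ n, ∀ i ∈ Finset.Icc 1 s, (d : ℚ) ^ (s - i) * r i k ∈ Sq q)
    (u : ℕ) (hu : u ≤ n) (hz : R (-u + 1 / (N : ℚ)) = 0) :
    (d : ℚ) ^ s * ∑ k ∈ Finset.Icc u n, ∑ i ∈ Finset.Icc 1 s, r i k / ((k : ℚ) - u + 1 / (N : ℚ)) ^ i
      ∈ Sq q := by
  by_cases hbad : ∃ k ∈ Finset.Icc u n, (d : ℚ) / (k - u + 1 / (N : ℚ)) ∉ Sq q
  · have := swap_mem n s d N R r hd0 hN hd hr hcoef u hu hbad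
    rwa [hz, sub_zero] at this
  · push Not at hbad
    rw [Finset.mul_sum]
    refine sum_mem fun k hk => ?_
    have := term_mem (q := q) s d 1 (fun i => r i k) ((k : ℚ) - u + 1 / (N : ℚ))
      (hcoef k (Finset.mem_Icc.1 hk).2) (by simpa using hbad k hk)
    simpa using this

lemma div_good {q : ℕ} [Fact q.Prime] (hN : 2 ≤ N) (e : ℕ)
    (u k : ℕ) (huk : u ≤ k) (h : ((k - u) * N + 1) ∣ e * d) :
    (e * d : ℚ) / (k - u + 1 / (N : ℚ)) ∈ Sq q := by
  have h1 := div_mem_Sq_of_dvd (q := q) (a := (e * d : ℕ)) (b := ((k - u) * N + 1 : ℕ))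
    (by exact_mod_cast h)
  have h2 : (e * d : ℚ) / (k - u + 1 / (N : ℚ)) =
      N * ((((e * d : ℕ) : ℤ) : ℚ) / ((((k - u) * N + 1 : ℕ) : ℤ) : ℚ)) := by
    have hN0 : (N : ℚ) ≠ 0 := by positivity
    push_cast [Nat.cast_sub huk]
    have h3 : (k : ℚ) - u + 1 / N = ((k - u) * N + 1) / N := by field_simp
    rw [h3, div_div_eq_mul_div]; ring
  rw [h2]
  exact mul_mem (nat_mem_Sq N) h1

lemma core_a (hd0 : d ≠ 0) (hN : 2 ≤ N) (hnc : n = N * c) (hmc : m + c = n)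
    (hd : ∀ j, 1 ≤ j → j ≤ n → j ∣ d)
    (hr : ∀ t : ℚ, (∀ j ∈ Finset.range (n + 1), t + (j : ℚ) ≠ 0) →
          R t = ∑ i ∈ Finset.Icc 1 s, ∑ k ∈ Finset.range (n + 1), r i k / (t + (k : ℚ)) ^ i)
    (hcoef : ∀ (q : ℕ) [Fact q.Prime], ∀ k ≤ n, ∀ i ∈ Finset.Icc 1 s, (d : ℚ) ^ (s - i) * r i k ∈ Sq q)
    (hz : ∀ u : ℕ, 1 ≤ u → u < m → R (-u + 1 / (N : ℚ)) = 0) :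
    ∃ z : ℤ, ((n : ℚ) + 1) ^ s * (d : ℚ) ^ s * (-∑ i ∈ Finset.Icc 1 s, ∑ k ∈ Finset.Icc 1 n,
      ∑ ν ∈ Finset.range k, r i k / ((ν : ℚ) + 1 / (N : ℚ)) ^ i) = z := by
  refine int_of_forall_Sq _ fun q _ => ?_
  rw [reindex_sum, mul_neg]
  refine neg_mem ?_
  rw [Finset.mul_sum]
  refine sum_mem fun u hu => ?_
  have hu' := Finset.mem_Icc.1 hu
  by_cases hum : u < m
  · rw [mul_assoc]
    refine mul_mem (pow_mem ?_ _) (tail_mem_of_zero n s d N R r hd0 hN hd hr (hcoef q) u hu'.2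
      (hz u hu'.1 hum))
    exact_mod_cast nat_mem_Sq (q := q) (n + 1)
  · rw [Finset.mul_sum]
    refine sum_mem fun k hk => ?_
    have hk' := Finset.mem_Icc.1 hk
    have := term_mem (q := q) s d (n + 1) (fun i => r i k) ((k : ℚ) - u + 1 / (N : ℚ))
      (hcoef q k hk'.2) (div_good d N hN (n + 1) u k hk'.1 ?_)
    · exact_mod_cast this
    · have h1 : (k - u) * N ≤ c * N := Nat.mul_le_mul_right _ (by omega)
      have h2 : (k - u) * N + 1 ≤ n + 1 := by rw [hnc, mul_comm N c]; omega
      rcases Nat.lt_or_ge ((k - u) * N + 1) (n + 1) with h | h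
      · exact (hd _ (by omega) (by omega)).mul_left _
      · exact Dvd.dvd.mul_right (by rw [le_antisymm h2 h]) _

lemma core_b [Fact (n + 1).Prime] (hd0 : d ≠ 0) (hN : 2 ≤ N) (hc : 1 ≤ c) (hnc : n = N * c) (hmc : m + c = n)
    (hd : ∀ j, 1 ≤ j → j ≤ n → j ∣ d) (hdl : ¬ (n + 1) ∣ d)
    (hr : ∀ t : ℚ, (∀ j ∈ Finset.range (n + 1), t + (j : ℚ) ≠ 0) →
          R t = ∑ i ∈ Finset.Icc 1 s, ∑ k ∈ Finset.range (n + 1), r i k / (t + (k : ℚ)) ^ i)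
    (hcoef : ∀ k ≤ n, ∀ i ∈ Finset.Icc 1 s, (d : ℚ) ^ (s - i) * r i k ∈ Sq (n + 1))
    (hz : ∀ u : ℕ, 1 ≤ u → u < m → R (-u + 1 / (N : ℚ)) = 0) :
    (-∑ i ∈ Finset.Icc 1 s, ∑ k ∈ Finset.Icc 1 n,
      ∑ ν ∈ Finset.range k, r i k / ((ν : ℚ) + 1 / (N : ℚ)) ^ i) + R (-m + 1 / (N : ℚ)) ∈ Sq (n + 1) := by
  have hdq : (d : ℚ) ≠ 0 := by exact_mod_cast hd0
  have hm1 : 1 ≤ m := by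
    have : 2 * c ≤ N * c := Nat.mul_le_mul_right _ hN
    omega
  suffices h : (d : ℚ) ^ s * ((-∑ i ∈ Finset.Icc 1 s, ∑ k ∈ Finset.Icc 1 n,
      ∑ ν ∈ Finset.range k, r i k / ((ν : ℚ) + 1 / (N : ℚ)) ^ i) + R (-m + 1 / (N : ℚ))) ∈ Sq (n + 1) by
    have h2 := mul_mem (pow_mem (inv_nat_mem_Sq hdl) s) h
    rwa [← mul_assoc, ← mul_pow, inv_mul_cancel₀ hdq, one_pow, one_mul] at h2
  have hmm : m ∈ Finset.Icc 1 n := Finset.mem_Icc.2 ⟨hm1, by omega⟩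
  rw [reindex_sum, ← Finset.add_sum_erase _ _ hmm]
  have hNl : ¬ (n + 1) ∣ N := by
    intro h
    have h1 := Nat.le_of_dvd (by omega) h
    have : N * 1 ≤ N * c := Nat.mul_le_mul_left _ hc
    omega
  have hmain := swap_mem (q := n + 1) n s d N R r hd0 hN hd hr hcoef m (by omega)
    ⟨n, Finset.mem_Icc.2 ⟨by omega, le_rfl⟩, by
      have hN0 : (N : ℚ) ≠ 0 := by positivity
      have hl0 : (((n + 1 : ℕ)) : ℚ) ≠ 0 := by positivity
      have h1 : (n : ℚ) - m + 1 / N = ((n + 1 : ℕ) : ℚ) / N := by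
        have e1 : (m : ℚ) + c = n := by exact_mod_cast hmc
        have e2 : (n : ℚ) = N * c := by exact_mod_cast hnc
        field_simp
        push_cast
        linear_combination N * (-e1) + (-1 : ℚ) * e2
      rw [h1, mem_Sq, not_le, padicNorm.div, padicNorm.div, (padicNorm.nat_eq_one_iff N).2 hNl,
        (padicNorm.nat_eq_one_iff d).2 hdl, div_one]
      have h2 := (padicNorm.nat_lt_one_iff (p := n + 1) (n + 1)).2 dvd_rfl
      have h3 : 0 < padicNorm (n + 1) ((n + 1 : ℕ) : ℚ) :=
        lt_of_le_of_ne (padicNorm.nonneg _) (padicNorm.nonzero hl0).symm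
      exact (one_lt_div h3).2 h2⟩
  have hrest : (d : ℚ) ^ s * ∑ u ∈ (Finset.Icc 1 n).erase m, ∑ k ∈ Finset.Icc u n,
      ∑ i ∈ Finset.Icc 1 s, r i k / ((k : ℚ) - u + 1 / (N : ℚ)) ^ i ∈ Sq (n + 1) := by
    rw [Finset.mul_sum]
    refine sum_mem fun u hu => ?_
    have hu0 := Finset.mem_erase.1 hu
    have hu' := Finset.mem_Icc.1 hu0.2
    by_cases hum : u < m
    · exact tail_mem_of_zero n s d N R r hd0 hN hd hr hcoef u hu'.2 (hz u hu'.1 hum)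
    · rw [Finset.mul_sum]
      refine sum_mem fun k hk => ?_
      have hk' := Finset.mem_Icc.1 hk
      have := term_mem (q := n + 1) s d 1 (fun i => r i k) ((k : ℚ) - u + 1 / (N : ℚ))
        (hcoef k hk'.2) (div_good d N hN 1 u k hk'.1 ?_)
      · simpa using this
      · have h0 : k - u + 1 ≤ c := by have := hu0.1; omega
        have h1 : (k - u + 1) * N ≤ c * N := Nat.mul_le_mul_right _ h0
        have h2 : (k - u) * N + 1 ≤ n := by
          rw [hnc, mul_comm N c]
          rw [add_mul, one_mul] at h1
          omega
        exact (hd _ (by omega) (by omega)).mul_left _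
  have := neg_mem (add_mem hmain hrest)
  convert this using 1
  ring
end core

lemma Z_spec (K : ℕ) (hK : 2 ≤ K) (Ψ : Finset ℕ) (hΨ1 : ∀ b ∈ Ψ, 1 ≤ b) (x : ℚ)
    (h : ∃ a b : ℕ, b ∈ Ψ ∧ 1 ≤ a ∧ a ≤ K * b ∧
      Nat.gcd a (K * b) = 1 ∧ x = (a : ℚ) / ((K * b : ℕ) : ℚ)) :
    ∃ a b : ℕ, b ∈ Ψ ∧ 1 ≤ a ∧ a < K * b ∧ Nat.gcd a (K * b) = 1 ∧ x = (a : ℚ) / ((K * b : ℕ) : ℚ)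
      ∧ x.den = K * b := by
  obtain ⟨a, b, hb, ha1, ha2, hg, hx⟩ := h
  have hb1 := hΨ1 b hb
  have hKb : 2 ≤ K * b := le_trans hK (Nat.le_mul_of_pos_right _ hb1)
  refine ⟨a, b, hb, ha1, ?_, hg, hx, ?_⟩
  · rcases Nat.lt_or_ge a (K * b) with h | h
    · exact h
    · have : a = K * b := le_antisymm ha2 h
      rw [this, Nat.gcd_self] at hg
      omega
  · have := Rat.den_div_eq_of_coprime (a := (a : ℤ)) (b := ((K * b : ℕ) : ℤ)) (by omega)
      (by rw [Int.natAbs_natCast, Int.natAbs_natCast]; exact hg)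
    rw [Int.cast_natCast, Int.cast_natCast] at this
    rw [hx]
    exact Int.natCast_inj.1 this

lemma prod_alpha_dvd (K : ℕ) (hK : 2 ≤ K) (Ψ : Finset ℕ) (hΨ1 : ∀ b ∈ Ψ, 1 ≤ b) (Z : Finset ℚ)
    (hZ : ∀ x ∈ Z, ∃ a b : ℕ, b ∈ Ψ ∧ 1 ≤ a ∧ a ≤ K * b ∧
      Nat.gcd a (K * b) = 1 ∧ x = (a : ℚ) / ((K * b : ℕ) : ℚ))
    (n : ℕ) (hn : ∀ b ∈ Ψ, ∀ q ∈ (K * b).primeFactors, (q - 1) ∣ n) :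
    ∏ θ ∈ Z, alphaD θ.den n ∣
      (∏ b ∈ Ψ, (K * b) ^ (K * b).totient) ^ n *
      (∏ b ∈ Ψ, ∏ q ∈ (K * b).primeFactors, q ^ ((K * b).totient / (q - 1))) ^ n := by
  have hmaps : ∀ θ ∈ Z, θ.den / K ∈ Ψ := by
    intro θ hθ
    obtain ⟨a, b, hb, _, _, _, _, hden⟩ := Z_spec K hK Ψ hΨ1 θ (hZ θ hθ)
    rw [hden, Nat.mul_div_cancel_left _ (by omega)]
    exact hb
  rw [← Finset.prod_fiberwise_of_maps_to hmaps, ← Finset.prod_pow, ← Finset.prod_pow,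
    ← Finset.prod_mul_distrib]
  refine Finset.prod_dvd_prod_of_dvd _ _ fun b hb => ?_
  have hb1 := hΨ1 b hb
  have hsub : Z.filter (fun θ => θ.den / K = b) ⊆
      ((Finset.range (K * b)).filter (fun a => (K * b).Coprime a)).image
        (fun a : ℕ => (a : ℚ) / ((K * b : ℕ) : ℚ)) := by
    intro θ hθ
    obtain ⟨hθ1, hθ2⟩ := Finset.mem_filter.1 hθ
    obtain ⟨a, b', hb', h1, h2, h3, h4, hden⟩ := Z_spec K hK Ψ hΨ1 θ (hZ θ hθ1)
    rw [hden, Nat.mul_div_cancel_left _ (by omega)] at hθ2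
    subst hθ2
    refine Finset.mem_image.2 ⟨a, Finset.mem_filter.2 ⟨Finset.mem_range.2 h2, ?_⟩, h4.symm⟩
    exact Nat.Coprime.symm h3
  have hcard : (Z.filter (fun θ => θ.den / K = b)).card ≤ (K * b).totient := by
    refine le_trans (Finset.card_le_card hsub) (le_trans Finset.card_image_le ?_)
    rw [Nat.totient_eq_card_coprime]
  have hconst : ∀ θ ∈ Z.filter (fun θ => θ.den / K = b), alphaD θ.den n = alphaD (K * b) n := by
    intro θ hθ
    obtain ⟨hθ1, hθ2⟩ := Finset.mem_filter.1 hθ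
    obtain ⟨a, b', hb', h1, h2, h3, h4, hden⟩ := Z_spec K hK Ψ hΨ1 θ (hZ θ hθ1)
    rw [hden, Nat.mul_div_cancel_left _ (by omega)] at hθ2
    subst hθ2
    rw [hden]
  rw [Finset.prod_congr rfl hconst, Finset.prod_const]
  refine (pow_dvd_pow _ hcard).trans (dvd_of_eq ?_)
  unfold alphaD
  rw [mul_pow, ← pow_mul, ← pow_mul, mul_comm n, ← Finset.prod_pow, ← Finset.prod_pow]
  congr 1
  refine Finset.prod_congr rfl fun q hq => ?_
  rw [← pow_mul, ← pow_mul]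
  congr 1
  have hq1 : (q - 1) ∣ (K * b).totient := by
    have h1 := Nat.mem_primeFactors.1 hq
    have := Nat.totient_dvd_of_dvd h1.2.1
    rwa [Nat.totient_prime h1.1] at this
  obtain ⟨x, hx⟩ := hn b hb q hq
  obtain ⟨y, hy⟩ := hq1
  have hq0 : 0 < q - 1 := by
    have := (Nat.mem_primeFactors.1 hq).1.two_le; omega
  rw [hy, hx, Nat.mul_div_cancel_left _ hq0, Nat.mul_div_cancel_left _ hq0]
  ring

lemma EE_eval (d : ℚ) (h : ℕ) (α x : ℚ) :
    (EE d h α).eval x = (h.factorial : ℚ)⁻¹ * ∏ j ∈ Finset.range h, (d * x + (α + j)) := by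
  simp [EE, eval_prod]

lemma exists_P {q : ℕ} [Fact q.Prime] (n s d k h e A : ℕ) (hk : k ≤ n) (hh : h ≤ n)
    (hd : ∀ j, 1 ≤ j → j ≤ n → j ∣ d) (Z : Finset ℚ) (θ₀ : ℚ) (hθ₀ : θ₀ ∈ Z)
    (he : s + 1 = e + Z.card)
    (hA : ∏ θ ∈ Z, alphaD θ.den n ∣ A) :
    ∃ P ∈ SX q, ∀ x : ℚ, P.eval x =
      ((A : ℚ) * ((n.factorial : ℚ) ^ e / (h.factorial : ℚ)) *
        (∏ j ∈ Finset.range h, (-(k : ℚ) + d * x + θ₀ + (j : ℚ))) *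
        (∏ θ ∈ Z.erase θ₀, ∏ j ∈ Finset.range n, (-(k : ℚ) + d * x + θ + (j : ℚ)))) /
      (∏ j ∈ (Finset.range (n + 1)).erase k, ((j : ℚ) - k)) ^ s := by
  obtain ⟨M, hM⟩ := hA
  set Pi := ∏ j ∈ (Finset.range (n + 1)).erase k, ((j : ℚ) - k) with hPi
  refine ⟨C (((n.factorial : ℚ) / Pi) ^ s) * C (M : ℚ) *
    (C (alphaD θ₀.den n : ℚ) * EE d h (((θ₀.num - k * θ₀.den : ℤ) : ℚ) / θ₀.den)) *
    ∏ θ ∈ Z.erase θ₀, (C (alphaD θ.den n : ℚ) * EE d n (((θ.num - k * θ.den : ℤ) : ℚ) / θ.den)),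
    ?_, ?_⟩
  · refine mul_mem (mul_mem (mul_mem (C_mem_SX (pow_mem (fact_div_prod_mem n k hk) _))
      (C_mem_SX (nat_mem_Sq M))) ?_) (prod_mem fun θ _ => ?_)
    · exact alphaD_EE_mem d n hd _ θ₀.den_nz _ _ hh
    · exact alphaD_EE_mem d n hd _ θ.den_nz _ _ le_rfl
  · intro x
    have hθ : ∀ θ : ℚ, ((θ.num - k * θ.den : ℤ) : ℚ) / θ.den = θ - k := by
      intro θ
      have h1 : (θ.den : ℚ) ≠ 0 := by exact_mod_cast θ.den_nz
      have h2 := Rat.mul_den_eq_num θ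
      push_cast
      rw [← h2]
      field_simp
    simp only [hθ, eval_mul, eval_C, eval_prod, EE_eval]
    have hpr : ∀ (θ : ℚ) (g : ℕ), ∏ j ∈ Finset.range g, ((d : ℚ) * x + (θ - k + j)) =
        ∏ j ∈ Finset.range g, (-(k : ℚ) + d * x + θ + (j : ℚ)) := by
      intro θ g
      exact Finset.prod_congr rfl fun j _ => by ring
    simp only [hpr]
    rw [hM, ← Finset.mul_prod_erase _ _ hθ₀]
    simp only [Finset.prod_mul_distrib, Finset.prod_const, Finset.card_erase_of_mem hθ₀]
    have hc : 1 ≤ Z.card := Finset.card_pos.2 ⟨_, hθ₀⟩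
    have hs : (n.factorial : ℚ) ^ s = n.factorial ^ e * n.factorial ^ (Z.card - 1) := by
      rw [← pow_add]; congr 1; omega
    have hf : (n.factorial : ℚ) ≠ 0 := by positivity
    have hf' : (n.factorial : ℚ) ^ (Z.card - 1) * ((n.factorial : ℚ)⁻¹) ^ (Z.card - 1) = 1 := by
      rw [← mul_pow, mul_inv_cancel₀ hf, one_pow]
    rw [div_pow, hs]
    push_cast
    rw [div_eq_mul_inv, div_eq_mul_inv, div_eq_mul_inv]
    linear_combination (n.factorial ^ e * (Pi ^ s)⁻¹ * M * alphaD θ₀.den n * (h.factorial : ℚ)⁻¹ *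
      (∏ j ∈ Finset.range h, (-(k : ℚ) + d * x + θ₀ + (j : ℚ))) * (∏ θ ∈ Z.erase θ₀, (alphaD θ.den n : ℚ)) *
      (∏ θ ∈ Z.erase θ₀, ∏ j ∈ Finset.range n, (-(k : ℚ) + d * x + θ + (j : ℚ)))) * hf'

lemma norm_prod_aux {l : ℕ} [Fact l.Prime] (J : Finset ℕ) (y : ℕ → ℤ)
    (huniq : ∀ i ∈ J, ∀ j ∈ J, (l : ℤ) ∣ y i → (l : ℤ) ∣ y j → i = j)
    (hsq : ∀ i ∈ J, ¬ ((l : ℤ) * l ∣ y i)) :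
    (l : ℚ)⁻¹ ≤ padicNorm l (((∏ j ∈ J, y j : ℤ)) : ℚ) := by
  have hl : l.Prime := Fact.out
  have hlp : Prime (l : ℤ) := Nat.prime_iff_prime_int.1 hl
  have hl1 : (1 : ℚ) ≤ l := by exact_mod_cast hl.one_lt.le
  by_cases h : ∃ i ∈ J, (l : ℤ) ∣ y i
  · obtain ⟨i, hi, hd⟩ := h
    obtain ⟨z, hz⟩ := id hd
    rw [← Finset.mul_prod_erase _ _ hi, hz]
    have h1 : ¬ (l : ℤ) ∣ z := by
      intro h; apply hsq i hi; rw [hz]; exact mul_dvd_mul_left _ h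
    have h2 : ¬ (l : ℤ) ∣ ∏ j ∈ J.erase i, y j := by
      rw [hlp.dvd_finsetProd_iff]
      rintro ⟨j, hj, hdj⟩
      have hj' := Finset.mem_erase.1 hj
      exact hj'.1 (huniq j hj'.2 i hi hdj hd)
    rw [Int.cast_mul, Int.cast_mul, padicNorm.mul, padicNorm.mul, (padicNorm.int_eq_one_iff _).2 h1,
      (padicNorm.int_eq_one_iff _).2 h2]
    simp
  · push Not at h
    have h2 : ¬ (l : ℤ) ∣ ∏ j ∈ J, y j := by
      rw [hlp.dvd_finsetProd_iff]
      rintro ⟨j, hj, hdj⟩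
      exact h j hj hdj
    rw [(padicNorm.int_eq_one_iff _).2 h2]
    exact inv_le_one_of_one_le₀ hl1

lemma norm_theta {n : ℕ} [Fact (n + 1).Prime] (N D a m : ℕ) (hN : 2 ≤ N) (hD : 2 ≤ D) (hDN : D ≤ N)
    (ha1 : 1 ≤ a) (haD : a < D) (hm : m ≤ n) (hn : 2 * N * N ≤ n)
    (hne : (a : ℚ) / D ≠ ((N : ℚ) - 1) / N) :
    ((n + 1 : ℕ) : ℚ)⁻¹ ≤ padicNorm (n + 1)
      (∏ j ∈ Finset.range n, (-(m : ℚ) + 1 / N + (a : ℚ) / D + (j : ℚ))) := by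
  have hl : (n + 1).Prime := Fact.out
  have hlp : Prime ((n + 1 : ℕ) : ℤ) := Nat.prime_iff_prime_int.1 hl
  have hN0 : (N : ℚ) ≠ 0 := by positivity
  have hD0 : (D : ℚ) ≠ 0 := by positivity
  have hNn : N ≤ n := by nlinarith
  set y : ℕ → ℤ := fun j => (N : ℤ) * D * ((j : ℤ) - m) + D + a * N with hy
  have hND : ¬ (((n + 1 : ℕ) : ℤ) ∣ (N : ℤ) * D) := by
    intro h
    rcases hlp.dvd_or_dvd h with h | h
    · have := Nat.le_of_dvd (by omega) (Int.natCast_dvd_natCast.1 h); omega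
    · have := Nat.le_of_dvd (by omega) (Int.natCast_dvd_natCast.1 h); omega
  have h1 : ∀ j : ℕ, -(m : ℚ) + 1 / N + (a : ℚ) / D + (j : ℚ) = (y j : ℚ) * (((N : ℤ) * D : ℤ) : ℚ)⁻¹ := by
    intro j
    simp only [hy]
    push_cast
    field_simp
    ring
  have hinv : padicNorm (n + 1) ((((N : ℤ) * D : ℤ) : ℚ)⁻¹) = 1 := by
    rw [← one_div, padicNorm.div, (padicNorm.int_eq_one_iff _).2 hND]; simp
  have hprod : ∏ j ∈ Finset.range n, (-(m : ℚ) + 1 / N + (a : ℚ) / D + (j : ℚ)) =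
      ((∏ j ∈ Finset.range n, y j : ℤ) : ℚ) * ((((N : ℤ) * D : ℤ) : ℚ)⁻¹) ^ n := by
    rw [Finset.prod_congr rfl fun j _ => h1 j, Finset.prod_mul_distrib, Finset.prod_const,
      Finset.card_range]
    push_cast; rfl
  rw [hprod, padicNorm.mul, padicNorm_pow_aux, hinv, one_pow, mul_one]
  refine norm_prod_aux _ _ ?_ ?_
  · intro i hi j hj hdi hdj
    have hi' := Finset.mem_range.1 hi
    have hj' := Finset.mem_range.1 hj
    have h2 : ((n + 1 : ℕ) : ℤ) ∣ (N : ℤ) * D * ((i : ℤ) - j) := by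
      have := dvd_sub hdi hdj
      have e : y i - y j = (N : ℤ) * D * ((i : ℤ) - j) := by
        simp only [hy]; ring
      rwa [← e]
    rcases hlp.dvd_or_dvd h2 with h | h
    · exact absurd h hND
    · have := Int.eq_zero_of_abs_lt_dvd h (by rw [abs_lt]; push_cast; omega)
      omega
  · intro i hi hdvd
    have hi' := Finset.mem_range.1 hi
    have hy0 : y i ≠ 0 := by
      intro h0
      -- then 1/N + a/D is an integer strictly between 0 and 2
      have hb1 : (N : ℤ) * D * ((m : ℤ) - i) = D + a * N := by
        simp only [hy] at h0; linarith
      have hpos : (0 : ℤ) < D + a * N := by positivity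
      have hND0 : (0 : ℤ) < (N : ℤ) * D := by positivity
      have hlt : (D : ℤ) + a * N < (N : ℤ) * D * 2 := by
        have e1 : (D : ℤ) ≤ N := by exact_mod_cast hDN
        have e2 : (a : ℤ) + 1 ≤ D := by exact_mod_cast haD
        have e3 : (2 : ℤ) ≤ D := by exact_mod_cast hD
        nlinarith
      have g1 : 0 < (m : ℤ) - i := by
        by_contra hc; push Not at hc; nlinarith
      have g2 : (m : ℤ) - i < 2 := by
        by_contra hc; push Not at hc; nlinarith
      have g3 : (m : ℤ) - i = 1 := by omega
      rw [g3, mul_one] at hb1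
      apply hne
      have hb2 : (N : ℚ) * D = D + a * N := by exact_mod_cast hb1
      rw [div_eq_div_iff hD0 hN0]
      linarith
    have habs : |y i| < ((n + 1 : ℕ) : ℤ) * ((n + 1 : ℕ) : ℤ) := by
      have e1 : (D : ℤ) ≤ N := by exact_mod_cast hDN
      have e2 : (a : ℤ) + 1 ≤ D := by exact_mod_cast haD
      have e3 : (2 : ℤ) ≤ D := by exact_mod_cast hD
      have e4 : (0 : ℤ) ≤ a := by positivity
      have e5 : (m : ℤ) ≤ n := by exact_mod_cast hm
      have e6 : (i : ℤ) < n := by exact_mod_cast hi'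
      have e7 : (2 : ℤ) * N * N ≤ n := by exact_mod_cast hn
      have e8 : (0 : ℤ) ≤ i := by positivity
      have e9 : (0 : ℤ) ≤ m := by positivity
      have f1 : (N : ℤ) * D ≤ N * N := by nlinarith
      have f2 : (a : ℤ) * N ≤ N * N := by nlinarith
      have f3 : (N : ℤ) ≤ N * N := by nlinarith
      have f0 : (0 : ℤ) ≤ (N : ℤ) * D := by positivity
      have f4 : (N : ℤ) * D * ((i : ℤ) - m) ≤ N * N * n := by nlinarith
      have f5 : -((N : ℤ) * N * n) ≤ (N : ℤ) * D * ((i : ℤ) - m) := by nlinarith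
      have f6 : (2 : ℤ) * N * N * (n + 2) ≤ n * (n + 2) := by nlinarith
      have f7 : (0 : ℤ) ≤ a * N := by positivity
      have hbound : (N : ℤ) * N * n + 2 * (N * N) < ((n + 1 : ℕ) : ℤ) * ((n + 1 : ℕ) : ℤ) := by
        push_cast; nlinarith
      rw [abs_lt]
      simp only [hy]
      constructor <;> linarith
    exact hy0 (Int.eq_zero_of_abs_lt_dvd hdvd habs)

lemma dd_dvd (n j : ℕ) (h1 : 1 ≤ j) (h2 : j ≤ n) : j ∣ dd n :=
  Finset.dvd_lcm (f := id) (Finset.mem_Icc.2 ⟨h1, h2⟩)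

lemma dd_dvd_factorial (n : ℕ) : dd n ∣ n.factorial := by
  refine Finset.lcm_dvd fun j hj => ?_
  have := Finset.mem_Icc.1 hj
  exact Nat.dvd_factorial (Nat.lt_of_lt_of_le one_pos this.1) this.2

lemma two_le_pow_ellp (p : ℕ) (hp : p.Prime) : 2 ≤ p ^ ellp p := by
  have h1 : 1 ≤ ellp p := by
    unfold ellp; split_ifs <;> omega
  calc 2 ≤ p := hp.two_le
    _ = p ^ 1 := (pow_one p).symm
    _ ≤ p ^ ellp p := Nat.pow_le_pow_right hp.pos h1

lemma norm_nat_eq_one {l : ℕ} [Fact l.Prime] {x : ℕ} (h : ¬ l ∣ x) : padicNorm l (x : ℚ) = 1 :=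
  (padicNorm.nat_eq_one_iff x).2 h

lemma padicNorm_prod_aux {l : ℕ} [Fact l.Prime] {ι : Type*} (J : Finset ι) (f : ι → ℚ) :
    padicNorm l (∏ j ∈ J, f j) = ∏ j ∈ J, padicNorm l (f j) := by
  classical
  induction J using Finset.induction_on with
  | empty => simp
  | insert a J ha ih => rw [Finset.prod_insert ha, Finset.prod_insert ha, padicNorm.mul, ih]

/-- Lower bound for the norm of the value `R(-m + 1/N)`. -/
lemma norm_R_lower {n : ℕ} [Fact (n + 1).Prime] (N c m A e s : ℕ) (hN : 2 ≤ N) (hc : 1 ≤ c)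
    (hnc : n = N * c) (hmc : m + c = n) (hA : ¬ (n + 1) ∣ A) (hn : 2 * N * N ≤ n)
    (Z : Finset ℚ) (hθ : ((N : ℚ) - 1) / N ∈ Z)
    (hZ : ∀ x ∈ Z, ∃ a D : ℕ, 2 ≤ D ∧ D ≤ N ∧ 1 ≤ a ∧ a < D ∧ x = (a : ℚ) / D) :
    ((n + 1 : ℕ) : ℚ) ^ ((s : ℤ) + 1 - Z.card) ≤ padicNorm (n + 1)
      ((A : ℚ) * ((n.factorial : ℚ) ^ e / ((m - 1).factorial : ℚ)) *
        (∏ j ∈ Finset.range (m - 1), (-(m : ℚ) + 1 / N + ((N : ℚ) - 1) / N + (j : ℚ))) *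
        (∏ θ ∈ Z.erase (((N : ℚ) - 1) / N), ∏ j ∈ Finset.range n, (-(m : ℚ) + 1 / N + θ + (j : ℚ))) /
        (∏ j ∈ Finset.range (n + 1), (-(m : ℚ) + 1 / N + (j : ℚ))) ^ s) := by
  have hl : (n + 1).Prime := Fact.out
  have hlp : Prime ((n + 1 : ℕ) : ℤ) := Nat.prime_iff_prime_int.1 hl
  have hN0 : (N : ℚ) ≠ 0 := by positivity
  have hl0 : (0 : ℚ) < ((n + 1 : ℕ) : ℚ) := by positivity
  have hl1 : (1 : ℚ) ≤ ((n + 1 : ℕ) : ℚ) := by exact_mod_cast hl.one_lt.le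
  have hm1 : 1 ≤ m := by
    have : 2 * c ≤ N * c := Nat.mul_le_mul_right _ hN
    omega
  have hf : ∀ g ≤ n, padicNorm (n + 1) (g.factorial : ℚ) = 1 := by
    intro g hg
    refine norm_nat_eq_one ?_
    rw [hl.dvd_factorial]; omega
  have hT1 : padicNorm (n + 1) (∏ j ∈ Finset.range (m - 1),
      (-(m : ℚ) + 1 / N + ((N : ℚ) - 1) / N + (j : ℚ))) = 1 := by
    rw [padicNorm_prod_aux]
    refine Finset.prod_eq_one fun j hj => ?_
    have hj' := Finset.mem_range.1 hj
    have : -(m : ℚ) + 1 / N + ((N : ℚ) - 1) / N + (j : ℚ) = (((j : ℤ) + 1 - m : ℤ) : ℚ) := by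
      push_cast; field_simp; ring
    rw [this, padicNorm.int_eq_one_iff]
    intro hdvd
    have := Int.eq_zero_of_abs_lt_dvd hdvd (by rw [abs_lt]; push_cast; omega)
    omega
  have hT2 : ((n + 1 : ℕ) : ℚ)⁻¹ ^ (Z.card - 1) ≤ padicNorm (n + 1)
      (∏ θ ∈ Z.erase (((N : ℚ) - 1) / N), ∏ j ∈ Finset.range n, (-(m : ℚ) + 1 / N + θ + (j : ℚ))) := by
    rw [padicNorm_prod_aux, ← Finset.card_erase_of_mem hθ, ← Finset.prod_const]
    refine Finset.prod_le_prod (fun _ _ => by positivity) fun θ hθ' => ?_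
    obtain ⟨h1, h2⟩ := Finset.mem_erase.1 hθ'
    obtain ⟨a, D, hD, hDN, ha1, haD, rfl⟩ := hZ θ h2
    exact norm_theta N D a m hN hD hDN ha1 haD (by omega) hn h1
  have hNl : ¬ (n + 1) ∣ N := by
    intro h
    have h1 := Nat.le_of_dvd (by omega) h
    have : N * 1 ≤ N * c := Nat.mul_le_mul_left _ hc
    omega
  have hDen : padicNorm (n + 1) (∏ j ∈ Finset.range (n + 1), (-(m : ℚ) + 1 / N + (j : ℚ))) ≤
      ((n + 1 : ℕ) : ℚ)⁻¹ := by
    rw [Finset.prod_range_succ, padicNorm.mul]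
    have h1 : -(m : ℚ) + 1 / N + n = ((n + 1 : ℕ) : ℚ) / N := by
      have e1 : (m : ℚ) + c = n := by exact_mod_cast hmc
      have e2 : (n : ℚ) = N * c := by exact_mod_cast hnc
      field_simp
      push_cast
      linear_combination N * (-e1) + (-1 : ℚ) * e2
    have h2 : padicNorm (n + 1) (((n + 1 : ℕ) : ℚ) / N) = ((n + 1 : ℕ) : ℚ)⁻¹ := by
      rw [padicNorm.div, norm_nat_eq_one hNl, div_one, padicNorm.padicNorm_p hl.one_lt]
    rw [h1, h2]
    have h3 : ∏ j ∈ Finset.range n, (-(m : ℚ) + 1 / N + (j : ℚ)) ∈ Sq (n + 1) := by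
      refine prod_mem fun j _ => add_mem (add_mem (neg_mem (nat_mem_Sq m)) ?_) (nat_mem_Sq j)
      rw [one_div]; exact inv_nat_mem_Sq hNl
    exact mul_le_of_le_one_left (by positivity) h3
  have hDen0 : 0 < padicNorm (n + 1) (∏ j ∈ Finset.range (n + 1), (-(m : ℚ) + 1 / N + (j : ℚ))) := by
    refine lt_of_le_of_ne (padicNorm.nonneg _) (padicNorm.nonzero ?_).symm
    refine Finset.prod_ne_zero_iff.2 fun j _ h => ?_
    have := int_add_inv_ne N hN ((j : ℤ) - m)
    push_cast at this
    apply this; rw [← h]; ring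
  rw [padicNorm.div, padicNorm.mul, padicNorm.mul, padicNorm.mul, padicNorm.div, padicNorm_pow_aux,
    padicNorm_pow_aux, norm_nat_eq_one hA, hf n le_rfl, hf (m - 1) (by omega), hT1]
  simp only [one_pow, div_one, one_mul]
  rw [le_div_iff₀ (pow_pos hDen0 s)]
  refine le_trans ?_ hT2
  calc _ ≤ ((n + 1 : ℕ) : ℚ) ^ ((s : ℤ) + 1 - Z.card) * (((n + 1 : ℕ) : ℚ)⁻¹) ^ s := by
        gcongr
    _ = _ := by
      have hcard : 1 ≤ Z.card := Finset.card_pos.2 ⟨_, hθ⟩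
      rw [inv_pow, inv_pow, ← zpow_natCast, ← zpow_natCast, ← zpow_neg, ← zpow_neg,
        ← zpow_add₀ hl0.ne']
      congr 1
      omega

end helpers

/-- Lemma 5.6: for all sufficiently large `n ∈ I` (i.e. `n+1`
prime and `P_B p^{l_p} b_max ∣ n`), with
`ρ_{0,θ_min} = -∑_{i=1}^s ∑_{k=1}^n ∑_{ν=0}^{k-1} r_{i,k}/(ν+θ_min)^i`:
(a) `(n+1)^s d_n^s ρ_{0,θ_min} ∈ ℤ`, and
(b) `ρ_{0,θ_min} ≠ 0` and `v_{n+1}(ρ_{0,θ_min}) ≤ -s + |𝒵_B| - 1`. -/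
theorem rho_0_theta_min_valuation
    (p : ℕ) [Fact p.Prime] (B : ℝ) (Ψ : Finset ℕ)
    (hΨ : ∀ b : ℕ, b ∈ Ψ ↔ 1 ≤ b ∧ ((p ^ ellp p * b).totient : ℝ) ≤ B)
    (bmax : ℕ) (hbmem : bmax ∈ Ψ) (hbmax : ∀ b ∈ Ψ, b ≤ bmax)
    (Z : Finset ℚ)
    (hZ : ∀ x : ℚ, x ∈ Z ↔ ∃ a b : ℕ, b ∈ Ψ ∧ 1 ≤ a ∧ a ≤ p ^ ellp p * b ∧
      Nat.gcd a (p ^ ellp p * b) = 1 ∧ x = (a : ℚ) / ((p ^ ellp p * b : ℕ) : ℚ))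
    (s : ℕ) (hsodd : Odd s) (hscard : Z.card + 1 < s) :
    ∃ n₀ : ℕ, ∀ n : ℕ, n₀ ≤ n → (n + 1).Prime →
      ((Ψ.biUnion fun b => (p ^ ellp p * b).primeFactors).lcm (fun q => q - 1)) *
        p ^ ellp p * bmax ∣ n →
      (2 : ℤ) ≤ ((n : ℤ) + 1) * s - n * ((Z.card : ℤ) - 1) -
        (((p ^ ellp p * bmax - 1) * n / (p ^ ellp p * bmax) : ℕ) : ℤ) + 1 →
      ∀ r : ℕ → ℕ → ℚ,
        (∀ t : ℚ, (∀ j ∈ Finset.range (n + 1), t + (j : ℚ) ≠ 0) →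
          Rfun p Ψ Z bmax s n t =
            ∑ i ∈ Finset.Icc 1 s, ∑ k ∈ Finset.range (n + 1), r i k / (t + (k : ℚ)) ^ i) →
        (∃ z : ℤ, ((n : ℚ) + 1) ^ s * (dd n : ℚ) ^ s *
            (-∑ i ∈ Finset.Icc 1 s, ∑ k ∈ Finset.Icc 1 n, ∑ ν ∈ Finset.range k,
              r i k / ((ν : ℚ) + 1 / ((p ^ ellp p * bmax : ℕ) : ℚ)) ^ i) = (z : ℚ)) ∧
        (-∑ i ∈ Finset.Icc 1 s, ∑ k ∈ Finset.Icc 1 n, ∑ ν ∈ Finset.range k,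
            r i k / ((ν : ℚ) + 1 / ((p ^ ellp p * bmax : ℕ) : ℚ)) ^ i) ≠ 0 ∧
        padicValRat (n + 1)
          (-∑ i ∈ Finset.Icc 1 s, ∑ k ∈ Finset.Icc 1 n, ∑ ν ∈ Finset.range k,
            r i k / ((ν : ℚ) + 1 / ((p ^ ellp p * bmax : ℕ) : ℚ)) ^ i)
          ≤ (Z.card : ℤ) - s - 1 := by
  have hp : p.Prime := Fact.out
  have hK := two_le_pow_ellp p hp
  set K := p ^ ellp p with hKdef
  set A1 : ℕ := ∏ b ∈ Ψ, (K * b) ^ (K * b).totient with hA1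
  set A2 : ℕ := ∏ b ∈ Ψ, ∏ q ∈ (K * b).primeFactors, q ^ ((K * b).totient / (q - 1)) with hA2
  have hΨ1 : ∀ b ∈ Ψ, 1 ≤ b := fun b hb => ((hΨ b).1 hb).1
  have hb1 := hΨ1 bmax hbmem
  set N := K * bmax with hNdef
  have hN : 2 ≤ N := le_trans hK (Nat.le_mul_of_pos_right _ hb1)
  have hA1pos : 0 < A1 := Finset.prod_pos fun b hb =>
    Nat.pow_pos (Nat.mul_pos (by omega) (hΨ1 b hb))
  have hA2pos : 0 < A2 := Finset.prod_pos fun b hb => Finset.prod_pos fun q hq =>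
    Nat.pow_pos (Nat.mem_primeFactors.1 hq).1.pos
  refine ⟨2 * N * N + A1 + A2, ?_⟩
  intro n hn0 hnp hdvd _ r hr
  haveI : Fact (n + 1).Prime := ⟨hnp⟩
  have hNn : N ∣ n := by
    refine dvd_trans ?_ hdvd
    rw [mul_assoc]
    exact Dvd.intro_left _ rfl
  obtain ⟨c, hnc⟩ := hNn
  have hn1 : 1 ≤ n := by have := hnp.two_le; omega
  have hc : 1 ≤ c := by
    rcases Nat.eq_zero_or_pos c with h | h
    · subst h; omega
    · exact h
  set m := n - c with hm
  have hcn : c ≤ n := by rw [hnc]; exact Nat.le_mul_of_pos_left _ (by omega)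
  have hmc : m + c = n := by omega
  have hmdef : (N - 1) * n / N = m := by
    rw [hm, hnc, mul_left_comm, Nat.mul_div_cancel_left _ (by omega), Nat.sub_mul, one_mul]
  have hqn : ∀ b ∈ Ψ, ∀ q ∈ (K * b).primeFactors, (q - 1) ∣ n := by
    intro b hb q hq
    refine dvd_trans ?_ hdvd
    rw [mul_assoc]
    refine Dvd.dvd.mul_right ?_ _
    exact Finset.dvd_lcm (f := fun q => q - 1) (Finset.mem_biUnion.2 ⟨b, hb, hq⟩)
  have hZ' : ∀ x ∈ Z, ∃ a b : ℕ, b ∈ Ψ ∧ 1 ≤ a ∧ a ≤ K * b ∧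
      Nat.gcd a (K * b) = 1 ∧ x = (a : ℚ) / ((K * b : ℕ) : ℚ) := fun x hx => (hZ x).1 hx
  have hθ : ((N : ℚ) - 1) / N ∈ Z := by
    rw [hZ]
    refine ⟨N - 1, bmax, hbmem, by omega, by omega, ?_, ?_⟩
    · have : Nat.Coprime (N - 1) (N - 1 + 1) := by simp
      rwa [Nat.sub_add_cancel (by omega)] at this
    · rw [Nat.cast_sub (by omega)]; simp [hNdef]
  have hAdvd := prod_alpha_dvd K hK Ψ hΨ1 Z hZ' n hqn
  set U : ℚ → ℚ := fun t => ((A1 ^ n * A2 ^ n : ℕ) : ℚ) *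
    ((Nat.factorial n : ℚ) ^ (s - Z.card + 1) / (Nat.factorial (m - 1) : ℚ)) *
    (∏ j ∈ Finset.range (m - 1), (t + ((N : ℚ) - 1) / N + (j : ℚ))) *
    (∏ θ ∈ Z.erase (((N : ℚ) - 1) / N), ∏ j ∈ Finset.range n, (t + θ + (j : ℚ))) with hU
  set R : ℚ → ℚ := Rfun p Ψ Z bmax s n with hRdef
  have hR : ∀ t, R t = U t / (∏ j ∈ Finset.range (n + 1), (t + (j : ℚ))) ^ s := by
    intro t
    have h1 : R t = (A1 : ℚ) ^ n * (A2 : ℚ) ^ n *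
      ((Nat.factorial n : ℚ) ^ (s - Z.card + 1) / (Nat.factorial ((N - 1) * n / N - 1) : ℚ)) *
      (∏ j ∈ Finset.range ((N - 1) * n / N - 1), (t + ((N : ℚ) - 1) / N + (j : ℚ))) *
      (∏ θ ∈ Z.erase (((N : ℚ) - 1) / N), ∏ j ∈ Finset.range n, (t + θ + (j : ℚ))) /
      (∏ j ∈ Finset.range (n + 1), (t + (j : ℚ))) ^ s := rfl
    rw [h1, hmdef, hU]
    push_cast
    rfl
  have hd0 : dd n ≠ 0 := ne_zero_of_dvd_ne_zero (Nat.factorial_ne_zero n) (dd_dvd_factorial n)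
  have hdl : ¬ (n + 1) ∣ dd n := by
    intro h
    have := hnp.dvd_factorial.1 (h.trans (dd_dvd_factorial n))
    omega
  have hcoef : ∀ (q : ℕ) [Fact q.Prime], ∀ k ≤ n, ∀ i ∈ Finset.Icc 1 s,
      (dd n : ℚ) ^ (s - i) * r i k ∈ Sq q := by
    intro q _ k hk
    obtain ⟨P, hP, hPe⟩ := exists_P (q := q) n s (dd n) k (m - 1) (s - Z.card + 1) (A1 ^ n * A2 ^ n)
      hk (by omega) (dd_dvd n) Z _ hθ (by omega) hAdvd
    exact coef_mem n s (dd n) k hk hd0 (dd_dvd n) U R hR r hr P hP hPe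
  have hz : ∀ u : ℕ, 1 ≤ u → u < m → R (-u + 1 / (N : ℚ)) = 0 := by
    intro u hu1 hum
    rw [hR]
    have hz1 : ∏ j ∈ Finset.range (m - 1), (-(u : ℚ) + 1 / (N : ℚ) + ((N : ℚ) - 1) / N + (j : ℚ)) = 0 := by
      refine Finset.prod_eq_zero (i := u - 1) (Finset.mem_range.2 (by omega)) ?_
      have hN0 : (N : ℚ) ≠ 0 := by positivity
      rw [Nat.cast_sub hu1]
      field_simp
      push_cast
      ring
    simp only [hU]
    rw [hz1]; simp
  refine ⟨core_a n s (dd n) N c m R r hd0 hN hnc hmc (dd_dvd n) hr hcoef hz, ?_⟩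
  have hb := core_b n s (dd n) N c m R r hd0 hN hc hnc hmc (dd_dvd n) hdl hr (hcoef (n + 1)) hz
  have hAl : ¬ (n + 1) ∣ A1 ^ n * A2 ^ n := by
    intro h
    rcases hnp.dvd_mul.1 h with h | h
    · have := Nat.le_of_dvd hA1pos (hnp.dvd_of_dvd_pow h); omega
    · have := Nat.le_of_dvd hA2pos (hnp.dvd_of_dvd_pow h); omega
  have hnorm := norm_R_lower (n := n) N c m (A1 ^ n * A2 ^ n) (s - Z.card + 1) s hN hc hnc hmc hAl
    (by omega) Z hθ (by
      intro x hx
      obtain ⟨a, b, hbΨ, h1, h2, _, h4, _⟩ := Z_spec K hK Ψ hΨ1 x (hZ' x hx)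
      exact ⟨a, K * b, le_trans hK (Nat.le_mul_of_pos_right _ (hΨ1 b hbΨ)),
        Nat.mul_le_mul_left _ (hbmax b hbΨ), h1, h2, h4⟩)
  have hR0 := hR (-m + 1 / (N : ℚ))
  simp only [hU] at hR0
  rw [← hR0] at hnorm
  set ρ : ℚ := -∑ i ∈ Finset.Icc 1 s, ∑ k ∈ Finset.Icc 1 n, ∑ ν ∈ Finset.range k,
              r i k / ((ν : ℚ) + 1 / (N : ℚ)) ^ i with hρ
  set R0 := R (-m + 1 / (N : ℚ)) with hR0def
  have hl1 : (1 : ℚ) < ((n + 1 : ℕ) : ℚ) := by exact_mod_cast hnp.one_lt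
  have hgt : 1 < padicNorm (n + 1) R0 :=
    lt_of_lt_of_le (one_lt_zpow₀ hl1 (by omega)) hnorm
  have hρn : padicNorm (n + 1) R0 ≤ padicNorm (n + 1) ρ := by
    by_contra hcon
    push Not at hcon
    have h1 := padicNorm.add_eq_max_of_ne hcon.ne
    rw [mem_Sq, h1] at hb
    exact absurd (le_trans (le_max_right _ _) hb) (not_le.2 hgt)
  have hρ0 : ρ ≠ 0 := by
    intro h
    rw [h, padicNorm.zero] at hρn
    linarith
  refine ⟨hρ0, ?_⟩
  have h2 := le_trans hnorm hρn
  rw [padicNorm.eq_zpow_of_nonzero hρ0, zpow_le_zpow_iff_right₀ hl1] at h2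
  linarith
end
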